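/- Fix n, m ≥ 1 and λ, ν ∈ Sig_n. For each μ ∈ Sig_n^+, let (c_{μ,ν}^{her,κ}(t))_{κ ∈ Sig_n} be the unique finitely supported family in ℤ[t] with P_μ(x_1², …, x_n²; t²) · P_ν(x_1,…,x_n; −t) = ∑_{κ ∈ Sig_n} c_{μ,ν}^{her,κ}(t) · P_κ(x_1,…,x_n; −t). Then ∑_{μ ∈ Sig_n^+} c_{μ,ν}^{her,λ}(t) · Q_{μ/0[n]}(x_1², …, x_m²; t²) = Q_{λ/ν}(x_1, −x_1, x_2, −x_2, …, x_m, −x_m; −t), as an identity of Laurent polynomials in x_1,…,x_m with coefficients in ℤ[t]; only finitely many summands are nonzero, since c_{μ,ν}^{her,λ} = 0 unless 2|μ| = |λ| − |ν|. Here Q_{λ/ν}(x_1, −x_1, …, x_m, −x_m; −t) denotes the substitution of the 2m values x_1, −x_1, …, x_m, −x_m and of −t for the parameter t. -/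

import Mathlib

open scoped Classical

noncomputable section

/-- Sum of the parts of an integer tuple. -/
def sumz {p : ℕ} (l : Fin p → ℤ) : ℤ := ∑ i, l i

/-- `mcount l c = m_c(l)`, the number of parts of `l` equal to `c`. -/
def mcount {p : ℕ} (l : Fin p → ℤ) (c : ℤ) : ℕ := (Finset.univ.filter fun j => l j = c).card

/-- `l` is a signature: its parts are weakly decreasing. -/
def IsSig {p : ℕ} (l : Fin p → ℤ) : Prop := ∀ i j : Fin p, i ≤ j → l j ≤ l i

/-- `μ ≺_P l`: `l i ≥ μ i ≥ l (i+1)` for all `i`. -/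
def interP {m : ℕ} (μ : Fin m → ℤ) (l : Fin (m + 1) → ℤ) : Prop :=
  ∀ i : Fin m, μ i ≤ l i.castSucc ∧ l i.succ ≤ μ i

/-- `ν ≺_Q l`: `l i ≥ ν i` for all `i`, and `ν i ≥ l (i+1)`. -/
def interQ {n : ℕ} (ν l : Fin n → ℤ) : Prop :=
  (∀ i, ν i ≤ l i) ∧ ∀ i j : Fin n, (j : ℕ) = (i : ℕ) + 1 → l j ≤ ν i

/-- `ψ_{l/μ}(t) = ∏_{i : m_i(μ) = m_i(l) + 1} (1 − t^{m_i(μ)})`. -/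
def psiHL {K : Type} [Field K] {p : ℕ} (t : K) (l : Fin (p + 1) → ℤ) (μ : Fin p → ℤ) : K :=
  ∏ᶠ c : ℤ, if mcount μ c = mcount l c + 1 then 1 - t ^ mcount μ c else 1

/-- `φ_{l/ν}(t) = ∏_{i : m_i(l) = m_i(ν) + 1} (1 − t^{m_i(l)})`. -/
def phiHL {K : Type} [Field K] {p : ℕ} (t : K) (l ν : Fin p → ℤ) : K :=
  ∏ᶠ c : ℤ, if mcount l c = mcount ν c + 1 then 1 - t ^ mcount l c else 1

/-- Skew Hall–Littlewood polynomial `P_{l/μ}(x₁,…,x_k;t)`, via the branching rule, as a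
function of `x : Fin k → K`. -/
def HLP {K : Type} [Field K] {m : ℕ} (t : K) :
    (k : ℕ) → (Fin m → ℤ) → (Fin (m + k) → ℤ) → (Fin k → K) → K
  | 0, μ, l, _ => if μ = l then 1 else 0
  | k + 1, μ, l, x =>
    ∑ᶠ ν : Fin (m + k) → ℤ,
      if interP ν l then
        psiHL t l ν * x (Fin.last k) ^ (sumz l - sumz ν) * HLP t k μ ν fun i => x i.castSucc
      else 0

/-- Skew Hall–Littlewood polynomial `Q_{l/ν}(x₁,…,x_k;t)` (`ν` and `l` both of length `n`),
via the branching rule, as a function of `x : Fin k → K`. -/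
def HLQ {K : Type} [Field K] {n : ℕ} (t : K) :
    (k : ℕ) → (Fin n → ℤ) → (Fin n → ℤ) → (Fin k → K) → K
  | 0, ν, l, _ => if ν = l then 1 else 0
  | k + 1, ν, l, x =>
    ∑ᶠ κ : Fin n → ℤ,
      if interQ κ l then
        phiHL t l κ * x (Fin.last k) ^ (sumz l - sumz κ) * HLQ t k ν κ fun i => x i.castSucc
      else 0

/-- The (non-skew) Hall–Littlewood polynomial `P_l(x₁,…,x_n;t) = P_{l/∅}(x₁,…,x_n;t)`. -/
def HLPfull {K : Type} [Field K] {n : ℕ} (t : K) (l : Fin n → ℤ) (x : Fin n → K) : K :=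
  HLP t n (fun i : Fin 0 => 0) (fun i => l (Fin.cast (Nat.zero_add n) i)) x

/-- `poch t m = (t;t)_m = ∏_{j=1}^m (1 − t^j)`. -/
def poch {K : Type} [Field K] (t : K) (m : ℕ) : K := ∏ j ∈ Finset.range m, (1 - t ^ (j + 1))


/-- The list `(x₁, −x₁, x₂, −x₂, …, x_m, −x_m)` of `2m` values. -/
def signList {K : Type} [Field K] {m : ℕ} (x : Fin m → K) : Fin (2 * m) → K :=
  fun i => (-1 : K) ^ (i.val % 2) * x ⟨i.val / 2, by have := i.isLt; omega⟩

/-- `c` is a finitely supported family of polynomials in `ℤ[t]`, supported on signatures, with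
`P_μ(x₁², …, x_n²; t²) · P_ν(x₁,…,x_n; −t) = ∑_λ c_λ(t) · P_λ(x₁,…,x_n; −t)` as Laurent
polynomials (formalized as holding over every field at nonzero arguments). -/
def herExpand (n : ℕ) (μ : Fin n → ℤ) (ν : Fin n → ℤ)
    (c : (Fin n → ℤ) → Polynomial ℤ) : Prop :=
  {l : Fin n → ℤ | c l ≠ 0}.Finite ∧ (∀ l, c l ≠ 0 → IsSig l) ∧
  ∀ (K : Type) [Field K] (t : K) (x : Fin n → K), (∀ i, x i ≠ 0) →
    HLPfull (t ^ 2) μ (fun i => x i ^ 2) * HLPfull (-t) ν x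
      = ∑ᶠ l : Fin n → ℤ, Polynomial.aeval t (c l) * HLPfull (-t) l x

/-- local weight -/
def Wloc {R : Type} [CommRing R] (t : R) (p q s : ℕ) : R :=
  (if s = p + 1 then 1 - t ^ s else 1) * (if q = s + 1 then 1 - t ^ q else 1)

/-- admissible edge state -/
def adm (h k : ℤ) : Prop := (h = 0 ∨ h = 1) ∧ (k = 0 ∨ k = 1)

/-- weight of a column of multiplicities, computed from the top. -/
def wt {R : Type} [CommRing R] (u : R) (e : ℤ) (w : ℕ → ℕ → ℕ → R) :
    (H : ℕ) → (ℕ → ℕ) → (ℕ → ℕ) → (Fin H → ℕ) → ℤ → ℤ → R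
  | 0, _, _, _, h, k => if h = 0 ∧ k = 1 then 1 else 0
  | H + 1, a, b, s, h, k =>
    if adm (h + e * (s 0 - a 0)) (k + e * (s 0 - b 0)) then
      w (a 0) (b 0) (s 0) * u ^ (h + e * (s 0 - a 0)).toNat *
        wt u e w H (fun j => a (j + 1)) (fun j => b (j + 1)) (fun j => s j.succ)
          (h + e * (s 0 - a 0)) (k + e * (s 0 - b 0))
    else 0

/-- the transfer recursion. -/
def GG {R : Type} [CommRing R] (u : R) (e : ℤ) (w : ℕ → ℕ → ℕ → R) (B : ℕ) :
    (H : ℕ) → (ℕ → ℕ) → (ℕ → ℕ) → ℤ → ℤ → R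
  | 0, _, _, h, k => if h = 0 ∧ k = 1 then 1 else 0
  | H + 1, a, b, h, k => ∑ s ∈ Finset.range B,
    if adm (h + e * (s - a 0)) (k + e * (s - b 0)) then
      w (a 0) (b 0) s * u ^ (h + e * (s - a 0)).toNat *
        GG u e w B H (fun j => a (j + 1)) (fun j => b (j + 1)) 
          (h + e * (s - a 0)) (k + e * (s - b 0))
    else 0

lemma sum_wt {R : Type} [CommRing R] (u : R) (e : ℤ) (w : ℕ → ℕ → ℕ → R) (B : ℕ) (H : ℕ) :
    ∀ (a b : ℕ → ℕ) (h k : ℤ), 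
    ∑ s : Fin H → Fin B, wt u e w H a b (fun j => (s j : ℕ)) h k = GG u e w B H a b h k := by
  induction H with
  | zero => intro a b h k; simp [wt, GG]
  | succ H ih =>
    intro a b h k
    rw [← (Fin.consEquiv (fun _ : Fin (H+1) => Fin B)).sum_comp, Fintype.sum_prod_type]
    simp only [GG, wt, Fin.consEquiv_apply, Fin.cons_zero, Fin.cons_succ]
    rw [← Fin.sum_univ_eq_sum_range (fun s => if adm (h + e * (s - a 0)) (k + e * (s - b 0)) then
      w (a 0) (b 0) s * u ^ (h + e * (s - a 0)).toNat *
        GG u e w B H (fun j => a (j + 1)) (fun j => b (j + 1)) 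
          (h + e * (s - a 0)) (k + e * (s - b 0))
    else 0)]
    refine Finset.sum_congr rfl fun s _ => ?_
    split_ifs
    · rw [← Finset.mul_sum, ih]
    · simp

/-- Sum over `s` with two possible values. -/
lemma two_sum {R : Type} [CommRing R] (B m : ℕ) (hB : m + 1 < B) (f : ℕ → R)
    (hf : ∀ s, s ≠ m → s ≠ m + 1 → f s = 0) : ∑ s ∈ Finset.range B, f s = f m + f (m + 1) := by
  rw [← Finset.sum_subset (s₁ := {m, m+1})]
  · rw [Finset.sum_pair (by omega)]
  · intro s; simp; omega
  · intro s _ hs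
    simp at hs
    exact hf s hs.1 hs.2

lemma three_sum {R : Type} [CommRing R] (B p : ℕ) (hB : p + 1 < B) (f : ℕ → R)
    (hf : ∀ s, s + 1 ≠ p → s ≠ p → s ≠ p + 1 → f s = 0) :
    ∑ s ∈ Finset.range B, f s = (if p = 0 then 0 else f (p - 1)) + f p + f (p + 1) := by
  rcases p with _ | p
  · rw [two_sum B 0 (by omega) f (fun s h1 h2 => hf s (by omega) h1 h2)]; simp
  · rw [← Finset.sum_subset (s₁ := {p, p+1, p+2})]
    · rw [Finset.sum_insert (by simp), Finset.sum_pair (by omega)]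
      simp; ring
    · intro s; simp; omega
    · intro s _ hs
      simp at hs
      exact hf s (by omega) (by omega) (by omega)

structure YBRel {R : Type} [CommRing R] (t u : R) (f g : ℤ → ℤ → R) : Prop where
  X : (1 - t * u) * g 0 0 = (1 - u) * f 0 0 + (1 - t) * u * f 1 1
  Y : (1 - t * u) * g 1 1 = (1 - t) * f 0 0 + t * (1 - u) * f 1 1
  E : (1 - t * u) * g 1 0 = (1 - t * u) * f 1 0
  F : (1 - t * u) * g 0 1 = (1 - t * u) * f 0 1

lemma gg_rel {R : Type} [CommRing R] (t u : R) (B : ℕ) (H : ℕ) :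
    ∀ (p q : ℕ → ℕ), (∀ j, p j + 1 < B) → (∀ j, q j + 1 < B) →
    YBRel t u (GG u 1 (Wloc t) B H p q) (GG u (-1) (fun a b s => Wloc t b a s) B H q p) := by
  induction H with
  | zero => intro p q hp hq; constructor <;> simp [GG]
  | succ H ih =>
    intro p q hp hq
    have := ih (fun j => p (j+1)) (fun j => q (j+1)) (fun j => hp _) (fun j => hq _)
    obtain ⟨hX, hY, hE, hF⟩ := this
    have hp0 := hp 0
    have hq0 := hq 0
    set f := GG u 1 (Wloc t) B H (fun j => p (j+1)) (fun j => q (j+1)) with hf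
    set g := GG u (-1) (fun a b s => Wloc t b a s) B H (fun j => q (j+1)) (fun j => p (j+1)) with hg
    have hGf : ∀ h k, GG u 1 (Wloc t) B (H+1) p q h k = ∑ s ∈ Finset.range B,
      if adm (h + s - p 0) (k + s - q 0) then
      Wloc t (p 0) (q 0) s * u ^ (h + s - p 0).toNat *
        f (h + s - p 0) (k + s - q 0) else 0 := by
      intro h k; simp only [GG, one_mul, add_sub_assoc]; rfl
    have hGg : ∀ h k, GG u (-1) (fun a b s => Wloc t b a s) B (H+1) q p h k =
      ∑ s ∈ Finset.range B,
      if adm (h - s + q 0) (k - s + p 0) then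
      Wloc t (p 0) (q 0) s * u ^ (h - s + q 0).toNat *
        g (h - s + q 0) (k - s + p 0) else 0 := by
      intro h k; simp only [GG, neg_mul, one_mul, neg_sub]
      refine Finset.sum_congr rfl fun s _ => ?_
      rw [show h + ((q 0 : ℤ) - s) = h - s + q 0 by ring,
        show k + ((p 0 : ℤ) - s) = k - s + p 0 by ring]
    generalize p 0 = P at *
    generalize q 0 = Q at *
    clear_value f g
    clear hf hg ih hp hq
    have hGf' : ∀ h k, (h = 0 ∨ h = 1) → GG u 1 (Wloc t) B (H+1) p q h k =
        (if P = 0 then 0 else if adm (h - 1) (k - 1 + (P - Q : ℤ)) then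
          Wloc t P Q (P - 1) * u ^ (h - 1).toNat * f (h - 1) (k - 1 + (P - Q : ℤ)) else 0)
        + (if adm h (k + (P - Q : ℤ)) then Wloc t P Q P * u ^ h.toNat * f h (k + (P - Q : ℤ)) else 0)
        + (if adm (h + 1) (k + 1 + (P - Q : ℤ)) then
          Wloc t P Q (P + 1) * u ^ (h + 1).toNat * f (h + 1) (k + 1 + (P - Q : ℤ)) else 0) := by
      intro h k hh
      rw [hGf, three_sum B P hp0 _ (by intro s h1 h2 h3; rw [if_neg]; unfold adm; omega)]
      congr 1
      · congr 1
        · rcases P with _ | P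
          · simp
          · simp only [Nat.add_sub_cancel, Nat.succ_ne_zero, if_false]
            rw [show h + (P:ℤ) - ((P+1:ℕ):ℤ) = h - 1 by push_cast; ring, show k + (P:ℤ) - (Q:ℤ) = k - 1 + (((P+1:ℕ):ℤ) - Q) by push_cast; ring]
        · rw [show h + (P:ℤ) - (P:ℤ) = h by push_cast; ring, show k + (P:ℤ) - (Q:ℤ) = k + ((P:ℤ) - Q) by push_cast; ring]
      · rw [show h + ((P+1:ℕ):ℤ) - (P:ℤ) = h + 1 by push_cast; ring, show k + ((P+1:ℕ):ℤ) - (Q:ℤ) = k + 1 + ((P:ℤ) - Q) by push_cast; ring]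
    have hGg' : ∀ h k, (k = 0 ∨ k = 1) →
        GG u (-1) (fun a b s => Wloc t b a s) B (H+1) q p h k =
        (if P = 0 then 0 else if adm (h + 1 - (P - Q : ℤ)) (k + 1) then
          Wloc t P Q (P - 1) * u ^ (h + 1 - (P - Q : ℤ)).toNat * g (h + 1 - (P - Q : ℤ)) (k + 1) else 0)
        + (if adm (h - (P - Q : ℤ)) k then
          Wloc t P Q P * u ^ (h - (P - Q : ℤ)).toNat * g (h - (P - Q : ℤ)) k else 0)
        + (if adm (h - 1 - (P - Q : ℤ)) (k - 1) then
          Wloc t P Q (P + 1) * u ^ (h - 1 - (P - Q : ℤ)).toNat * g (h - 1 - (P - Q : ℤ)) (k - 1) else 0) := by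
      intro h k hh
      rw [hGg, three_sum B P hp0 _ (by intro s h1 h2 h3; rw [if_neg]; unfold adm; omega)]
      congr 1
      · congr 1
        · rcases P with _ | P
          · simp
          · simp only [Nat.add_sub_cancel, Nat.succ_ne_zero, if_false]
            rw [show h - (P:ℤ) + (Q:ℤ) = h + 1 - (((P+1:ℕ):ℤ) - Q) by push_cast; ring, show k - (P:ℤ) + ((P+1:ℕ):ℤ) = k + 1 by push_cast; ring]
        · rw [show h - (P:ℤ) + (Q:ℤ) = h - ((P:ℤ) - Q) by push_cast; ring, show k - (P:ℤ) + (P:ℤ) = k by push_cast; ring]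
      · rw [show h - ((P+1:ℕ):ℤ) + (Q:ℤ) = h - 1 - ((P:ℤ) - Q) by push_cast; ring, show k - ((P+1:ℕ):ℤ) + (P:ℤ) = k - 1 by push_cast; ring]
    clear hGf hGg
    have f00 := hGf' 0 0 (by simp)
    have f11 := hGf' 1 1 (by simp)
    have f01 := hGf' 0 1 (by simp)
    have f10 := hGf' 1 0 (by simp)
    have g00 := hGg' 0 0 (by simp)
    have g11 := hGg' 1 1 (by simp)
    have g01 := hGg' 0 1 (by simp)
    have g10 := hGg' 1 0 (by simp)
    clear hGf' hGg'
    generalize GG u 1 (Wloc t) B (H+1) p q = ff at *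
    generalize GG u (-1) (fun a b s => Wloc t b a s) B (H+1) q p = gg at *
    have e1 : ∀ a : ℕ, (a = a + 1 + 1) = False := by intro a; simp; omega
    have e2 : ∀ a : ℕ, (a = a + 1 + 1 + 1) = False := by intro a; simp; omega
    rcases (show Q = P ∨ Q = P + 1 ∨ P = Q + 1 ∨ Q = P + 2 ∨ P = Q + 2 ∨ P + 2 < Q ∨ Q + 2 < P by omega)
      with h | h | h | h | h | h | h
    · subst h
      rcases Q with _ | Q
      all_goals
        simp [adm, Wloc, e1, e2] at f00 f11 f01 f10 g00 g11 g01 g10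
        constructor <;> simp only [f00, f11, f01, f10, g00, g11, g01, g10]
      · linear_combination hX
      · linear_combination (1-t)*hX + u*hY
      · linear_combination u * hE
      · linear_combination hF
      · linear_combination hX+u*(1-t^(Q+1))*hY
      · linear_combination (1-t^(Q+2))*hX + u*hY
      · linear_combination u * hE
      · linear_combination hF
    · subst h
      rcases P with _ | P
      all_goals
        simp [adm, Wloc, e1, e2] at f00 f11 f01 f10 g00 g11 g01 g10
        constructor <;> simp only [f00, f11, f01, f10, g00, g11, g01, g10]
      · linear_combination u * (1 - t) * hE
      · linear_combination u * (1 - t) * hE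
      · linear_combination (1-t)*(hX+u*hY)
      · linear_combination u * (1 - t^(P+2)) * hE
      · linear_combination u * (1 - t^(P+2)) * hE
      · linear_combination (1-t^(P+2))*(hX+u*hY)
    · subst h
      simp [adm, Wloc, e1, e2] at f00 f11 f01 f10 g00 g11 g01 g10
      constructor <;> simp only [f00, f11, f01, f10, g00, g11, g01, g10]
      · linear_combination hF
      · linear_combination hF
      · linear_combination hX + u * hY
    · subst h
      rcases P with _ | P
      all_goals
        simp [adm, Wloc, e1, e2] at f00 f11 f01 f10 g00 g11 g01 g10
        constructor <;> simp only [f00, f11, f01, f10, g00, g11, g01, g10]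
      all_goals try simp only [mul_zero, add_zero]
      · linear_combination (1-t)*(1-t^2)*u*hE
      · linear_combination (1-t^(P+2))*(1-t^(P+3))*u*hE
    · subst h
      simp [adm, Wloc, e1, e2] at f00 f11 f01 f10 g00 g11 g01 g10
      constructor <;> simp only [f00, f11, f01, f10, g00, g11, g01, g10]
      all_goals try simp only [mul_zero, add_zero]
      · linear_combination hF
    all_goals
      have nf : ∀ h i : ℤ, -1 ≤ i → i ≤ 2 → ¬ adm h (i + ((P : ℤ) - Q)) := by
        intro h i h1 h2; unfold adm; omega
      have ng : ∀ i k : ℤ, -1 ≤ i → i ≤ 2 → ¬ adm (i - ((P : ℤ) - Q)) k := by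
        intro h i h1 h2; unfold adm; omega
      have z1 : ff 0 0 = 0 := by
        rw [f00, if_neg (nf _ _ ?_ ?_), if_neg (nf _ _ ?_ ?_), if_neg (nf _ _ ?_ ?_)] <;> simp
      have z2 : ff 1 1 = 0 := by
        rw [f11, if_neg (nf _ _ ?_ ?_), if_neg (nf _ _ ?_ ?_), if_neg (nf _ _ ?_ ?_)] <;> simp
      have z3 : ff 0 1 = 0 := by
        rw [f01, if_neg (nf _ _ ?_ ?_), if_neg (nf _ _ ?_ ?_), if_neg (nf _ _ ?_ ?_)] <;> simp
      have z4 : ff 1 0 = 0 := by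
        rw [f10, if_neg (nf _ _ ?_ ?_), if_neg (nf _ _ ?_ ?_), if_neg (nf _ _ ?_ ?_)] <;> simp
      have z5 : gg 0 0 = 0 := by
        rw [g00, if_neg (ng _ _ ?_ ?_), if_neg (ng _ _ ?_ ?_), if_neg (ng _ _ ?_ ?_)] <;> simp
      have z6 : gg 1 1 = 0 := by
        rw [g11, if_neg (ng _ _ ?_ ?_), if_neg (ng _ _ ?_ ?_), if_neg (ng _ _ ?_ ?_)] <;> simp
      have z7 : gg 0 1 = 0 := by
        rw [g01, if_neg (ng _ _ ?_ ?_), if_neg (ng _ _ ?_ ?_), if_neg (ng _ _ ?_ ?_)] <;> simp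
      have z8 : gg 1 0 = 0 := by
        rw [g10, if_neg (ng _ _ ?_ ?_), if_neg (ng _ _ ?_ ?_), if_neg (ng _ _ ?_ ?_)] <;> simp
      constructor <;> simp [z1, z2, z3, z4, z5, z6, z7, z8]

/-- Top levels without any parts. -/
lemma gg_pad {R : Type} [CommRing R] (t u : R) (B H N : ℕ) (hB : 1 < B) :
    ∀ (p q : ℕ → ℕ), (∀ j, j < N → p j = 0) → (∀ j, j < N → q j = 0) →
    ∃ y : R, GG u 1 (Wloc t) B (N + H) p q 1 1 = u ^ N * y := by
  induction N with
  | zero => intro p q hp hq; exact ⟨_, by rw [pow_zero, one_mul]⟩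
  | succ N ih =>
    intro p q hp hq
    obtain ⟨y, hy⟩ := ih (fun j => p (j+1)) (fun j => q (j+1)) (fun j hj => hp _ (by omega))
      (fun j hj => hq _ (by omega))
    refine ⟨y, ?_⟩
    rw [show N + 1 + H = (N + H) + 1 by ring]
    simp only [GG, hp 0 (by omega), hq 0 (by omega)]
    rw [two_sum B 0 (by omega)]
    · simp [adm, Wloc, hy]
      ring
    · intro s h1 h2
      rw [if_neg]
      simp [adm]; omega

/-- number of parts at least `c`. -/
def cnt {p : ℕ} (l : Fin p → ℤ) (c : ℤ) : ℕ := (Finset.univ.filter fun j => c ≤ l j).card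

lemma cnt_succ {p : ℕ} (l : Fin p → ℤ) (c : ℤ) : cnt l c = cnt l (c + 1) + mcount l c := by
  unfold cnt mcount
  rw [← Finset.card_union_of_disjoint]
  · congr 1; ext j; simp; omega
  · rw [Finset.disjoint_filter]; intro j _ h1 h2; omega

lemma lt_cnt {p : ℕ} {l : Fin p → ℤ} (hl : IsSig l) (c : ℤ) (i : Fin p) :
    (i : ℕ) < cnt l c ↔ c ≤ l i := by
  constructor
  · intro h
    by_contra hc
    have : (Finset.univ.filter fun j => c ≤ l j) ⊆ Finset.Iio i := by
      intro j hj
      simp at hj ⊢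
      by_contra hji
      have := hl i j (by omega)
      omega
    have := Finset.card_le_card this
    simp at this
    unfold cnt at h
    omega
  · intro h
    have : Finset.Iic i ⊆ (Finset.univ.filter fun j => c ≤ l j) := by
      intro j hj
      simp at hj ⊢
      have := hl j i hj
      omega
    have := Finset.card_le_card this
    simp at this
    unfold cnt
    omega

lemma cnt_le {p : ℕ} (l : Fin p → ℤ) (c : ℤ) : cnt l c ≤ p := by
  unfold cnt; exact (Finset.card_le_univ _).trans (by simp)

lemma mcount_le {p : ℕ} (l : Fin p → ℤ) (c : ℤ) : mcount l c ≤ p := by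
  unfold mcount; exact (Finset.card_le_univ _).trans (by simp)

lemma cnt_top {p : ℕ} (l : Fin p → ℤ) (c : ℤ) (h : ∀ i, l i < c) : cnt l c = 0 := by
  unfold cnt; rw [Finset.card_eq_zero, Finset.filter_eq_empty_iff]
  intro i _; have := h i; omega

lemma cnt_bot {p : ℕ} (l : Fin p → ℤ) (c : ℤ) (h : ∀ i, c ≤ l i) : cnt l c = p := by
  unfold cnt; rw [Finset.filter_true_of_mem (fun i _ => h i)]; simp

lemma interQ_iff {n : ℕ} {ν l : Fin n → ℤ} (hν : IsSig ν) (hl : IsSig l) :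
    interQ ν l ↔ ∀ c, cnt ν c ≤ cnt l c ∧ cnt l c ≤ cnt ν c + 1 := by
  constructor
  · rintro ⟨h1, h2⟩ c
    constructor
    · by_contra hc
      have hn := cnt_le ν c
      have a := (lt_cnt hν c ⟨cnt l c, by omega⟩).1 (by simp; omega)
      have b := (lt_cnt hl c ⟨cnt l c, by omega⟩).2 (a.trans (h1 _))
      simp at b
    · by_contra hc
      have hn := cnt_le l c
      have a := (lt_cnt hl c ⟨cnt ν c + 1, by omega⟩).1 (by simp; omega)
      have b := (lt_cnt hν c ⟨cnt ν c, by omega⟩).2 (a.trans (h2 ⟨cnt ν c, by omega⟩ ⟨cnt ν c + 1, by omega⟩ rfl))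
      simp at b
  · intro h
    constructor
    · intro i
      rw [← lt_cnt hl]
      exact lt_of_lt_of_le ((lt_cnt hν _ i).2 le_rfl) (h _).1
    · intro i j hij
      rw [← lt_cnt hν]
      have a := (lt_cnt hl _ j).2 le_rfl
      have := (h (l j)).2
      omega

lemma interP_iff {n : ℕ} {ν : Fin n → ℤ} {l : Fin (n + 1) → ℤ} (hν : IsSig ν) (hl : IsSig l) :
    interP ν l ↔ ∀ c, cnt ν c ≤ cnt l c ∧ cnt l c ≤ cnt ν c + 1 := by
  constructor
  · intro h c
    constructor
    · by_contra hc
      have hn := cnt_le ν c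
      have a := (lt_cnt hν c ⟨cnt l c, by omega⟩).1 (by simp; omega)
      have b := (lt_cnt hl c ⟨cnt l c, by omega⟩).2 (a.trans (h ⟨cnt l c, by omega⟩).1)
      simp at b
    · by_contra hc
      have hn := cnt_le l c
      have a := (lt_cnt hl c ⟨cnt ν c + 1, by omega⟩).1 (by simp; omega)
      have b := (lt_cnt hν c ⟨cnt ν c, by omega⟩).2 (a.trans (h ⟨cnt ν c, by omega⟩).2)
      simp at b
  · intro h i
    constructor
    · rw [← lt_cnt hl]
      exact lt_of_lt_of_le ((lt_cnt hν _ i).2 le_rfl) (h _).1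
    · rw [← lt_cnt hν]
      have a := (lt_cnt hl _ i.succ).2 le_rfl
      have := (h (l i.succ)).2
      simp at a
      omega

lemma sum_cnt {p : ℕ} (l : Fin p → ℤ) (lo hi : ℤ) (h : ∀ i, lo ≤ l i ∧ l i < hi) :
    ∑ c ∈ Finset.Ico lo hi, (cnt l c : ℤ) = sumz l + p * (1 - lo) := by
  unfold cnt sumz
  simp only [Finset.card_filter]
  push_cast
  rw [Finset.sum_comm]
  have : ∀ i, ∑ c ∈ Finset.Ico lo hi, (if c ≤ l i then (1 : ℤ) else 0) = l i + (1 - lo) := by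
    intro i
    rw [← Finset.sum_filter]
    have e : (Finset.Ico lo hi).filter (fun c => c ≤ l i) = Finset.Icc lo (l i) := by
      ext c; simp; have := h i; omega
    rw [e]; simp; have := h i; omega
  simp [this, Finset.sum_add_distrib]; ring

lemma sig_ext {p : ℕ} {l l' : Fin p → ℤ} (hl : IsSig l) (hl' : IsSig l')
    (h : ∀ c, cnt l c = cnt l' c) : l = l' := by
  ext i
  apply le_antisymm
  · rw [← lt_cnt hl', ← h, lt_cnt hl]
  · rw [← lt_cnt hl, h, lt_cnt hl']

lemma sig_ext_mcount {p : ℕ} {l l' : Fin p → ℤ} (hl : IsSig l) (hl' : IsSig l')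
    (h : ∀ c, mcount l c = mcount l' c) : l = l' := by
  apply sig_ext hl hl'
  intro c
  unfold cnt
  have key : ∀ f : Fin p → ℤ, (Finset.univ.filter fun j => c ≤ f j).card =
      ∑ d ∈ (Finset.univ.image l ∪ Finset.univ.image l').filter (fun d => c ≤ d),
        (Finset.univ.filter fun j => c ≤ f j ∧ f j = d).card + 
        (Finset.univ.filter fun j => c ≤ f j ∧ f j ∉ (Finset.univ.image l ∪ Finset.univ.image l')).card := by
    intro f
    rw [← Finset.card_biUnion, ← Finset.card_union_of_disjoint]
    · congr 1; ext j; simp; grind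
    · rw [Finset.disjoint_left]; intro j; simp; grind
    · intro a ha b hb hab
      rw [Function.onFun, Finset.disjoint_filter]; grind
  rw [key l, key l']
  congr 1
  · refine Finset.sum_congr rfl fun d hd => ?_
    have hd' := (Finset.mem_filter.1 hd).2
    have := h d
    unfold mcount at this
    convert this using 2 <;> (ext j; simp; intro h; omega)
  · rw [Finset.filter_eq_empty_iff.2, Finset.filter_eq_empty_iff.2] <;> simp

lemma exists_sig {p : ℕ} (M : Multiset ℤ) (hM : Multiset.card M = p) :
    ∃ l : Fin p → ℤ, IsSig l ∧ ∀ c, mcount l c = M.count c := by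
  subst hM
  set L := M.sort (· ≥ ·) with hL
  have hlen : L.length = Multiset.card M := by simp [hL]
  refine ⟨fun i => L.get (i.cast hlen.symm), ?_, ?_⟩
  · intro i j hij
    have hs : L.Pairwise (· ≥ ·) := Multiset.pairwise_sort _ _
    rcases eq_or_lt_of_le hij with rfl | hij
    · exact le_rfl
    · exact List.pairwise_iff_get.1 hs (i.cast hlen.symm) (j.cast hlen.symm) hij
  · intro c
    have : M = (L : Multiset ℤ) := by simp [hL]
    conv_rhs => rw [this]
    have e2 : (L : Multiset ℤ) = (Finset.univ : Finset (Fin (Multiset.card M))).val.map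
        (fun i => L.get (i.cast hlen.symm)) := by
      have : (fun i : Fin (Multiset.card M) => L.get (i.cast hlen.symm)) = (fun i => L.get i) ∘ (finCongr hlen.symm) := rfl
      have hu : Multiset.map (finCongr hlen.symm) (Finset.univ : Finset (Fin (Multiset.card M))).val
          = (Finset.univ : Finset (Fin L.length)).val :=
        congrArg Finset.val (Finset.map_univ_equiv (finCongr hlen.symm))
      rw [this, ← Multiset.map_map, hu]
      simp [Fin.univ_val_map]
    rw [e2, Multiset.count_map, mcount]
    simp only [Finset.card, Finset.filter_val]
    congr 1
    apply Multiset.filter_congr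
    intros; exact eq_comm

lemma wt_closed {R : Type} [CommRing R] (u : R) (e : ℤ) (w : ℕ → ℕ → ℕ → R)
    (A B T : ℤ → ℤ) (a b s : ℤ → ℕ) (hA : ∀ c, A c = A (c + 1) + a c)
    (hB : ∀ c, B c = B (c + 1) + b c) (hT : ∀ c, T c = T (c + 1) + s c) (H : ℕ) : ∀ (hi : ℤ),
    wt u e w H (fun j => a (hi - 1 - j)) (fun j => b (hi - 1 - j)) (fun j => s (hi - 1 - (j : ℕ)))
      (e * (T hi - A hi)) (e * (T hi - B hi)) =
    if (∀ c ∈ Finset.Ico (hi - H) hi, adm (e * (T c - A c)) (e * (T c - B c))) ∧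
      (e * (T (hi - H) - A (hi - H)) = 0 ∧ e * (T (hi - H) - B (hi - H)) = 1) then
      ∏ c ∈ Finset.Ico (hi - H) hi, (w (a c) (b c) (s c) * u ^ (e * (T c - A c)).toNat) else 0 := by
  induction H with
  | zero => intro hi; simp [wt]
  | succ H ih =>
    intro hi
    have hh := ih (hi - 1)
    have hI : Finset.Ico (hi - (H + 1 : ℕ)) hi = insert (hi - 1) (Finset.Ico (hi - 1 - H) (hi - 1)) := by
      ext c; simp; omega
    have e1 : e * (T hi - A hi) + e * ((s (hi - 1) : ℤ) - a (hi - 1)) = e * (T (hi - 1) - A (hi - 1)) := by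
      rw [hT (hi - 1), hA (hi - 1)]; simp; ring
    have e2 : e * (T hi - B hi) + e * ((s (hi - 1) : ℤ) - b (hi - 1)) = e * (T (hi - 1) - B (hi - 1)) := by
      rw [hT (hi - 1), hB (hi - 1)]; simp; ring
    have e3 : hi - ((H + 1 : ℕ) : ℤ) = hi - 1 - H := by push_cast; ring
    rw [e3] at hI
    rw [wt]
    simp only [Fin.val_zero, Nat.cast_zero, sub_zero, e1, e2, e3, hI]
    have e4 : ∀ f : ℤ → ℕ, (fun j : ℕ => f (hi - 1 - ((j + 1 : ℕ) : ℤ))) = fun j : ℕ => f (hi - 1 - 1 - (j : ℤ)) := by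
      intro f; ext j; congr 1; push_cast; ring
    have e5 : (fun j : Fin H => s (hi - 1 - (((j.succ : Fin (H + 1)) : ℕ) : ℤ))) =
        fun j : Fin H => s (hi - 1 - 1 - ((j : ℕ) : ℤ)) := by
      ext j; congr 1; simp; ring
    rw [e4 a, e4 b, e5, hh]
    rw [Finset.prod_insert (by simp)]
    simp only [Finset.forall_mem_insert]
    by_cases h1 : adm (e * (T (hi - 1) - A (hi - 1))) (e * (T (hi - 1) - B (hi - 1)))
    · rw [if_pos h1]
      simp only [h1, true_and, mul_ite, mul_zero]
    · rw [if_neg h1, if_neg (by tauto)]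

lemma mcount_out {p : ℕ} (l : Fin p → ℤ) (c : ℤ) (h : ∀ i, l i ≠ c) : mcount l c = 0 := by
  unfold mcount; rw [Finset.card_eq_zero, Finset.filter_eq_empty_iff]; intro i _; exact h i

/-- values in a window -/
def InW {p : ℕ} (l : Fin p → ℤ) (lo hi : ℤ) : Prop := ∀ i, lo ≤ l i ∧ l i < hi

lemma wt_sig {R : Type} [CommRing R] (u : R) (e : ℤ) (w : ℕ → ℕ → ℕ → R) {p q : ℕ}
    (α τ : Fin p → ℤ) (β : Fin q → ℤ) (hi : ℤ) (H : ℕ)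
    (hα : InW α (hi - H) hi) (hβ : InW β (hi - H) hi) (hτ : InW τ (hi - H) hi)
    (he : e * ((p : ℤ) - q) = 1) :
    wt u e w H (fun j => mcount α (hi - 1 - j)) (fun j => mcount β (hi - 1 - j))
      (fun j => mcount τ (hi - 1 - (j : ℕ))) 0 0 =
    if (∀ c, adm (e * ((cnt τ c : ℤ) - cnt α c)) (e * ((cnt τ c : ℤ) - cnt β c))) then
      (∏ c ∈ Finset.Ico (hi - H) hi, w (mcount α c) (mcount β c) (mcount τ c)) *
        u ^ (e * (sumz τ - sumz α)).toNat else 0 := by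
  have h := wt_closed u e w (fun c => (cnt α c : ℤ)) (fun c => (cnt β c : ℤ)) (fun c => (cnt τ c : ℤ))
    (mcount α) (mcount β) (mcount τ) (fun c => by rw [cnt_succ α c]; push_cast; rfl)
    (fun c => by rw [cnt_succ β c]; push_cast; rfl) (fun c => by rw [cnt_succ τ c]; push_cast; rfl) H hi
  have top : ∀ c, hi ≤ c → cnt α c = 0 ∧ cnt β c = 0 ∧ cnt τ c = 0 := fun c hc =>
    ⟨cnt_top _ _ fun i => (hα i).2.trans_le hc, cnt_top _ _ fun i => (hβ i).2.trans_le hc,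
      cnt_top _ _ fun i => (hτ i).2.trans_le hc⟩
  have bot : ∀ c, c ≤ hi - H → cnt α c = p ∧ cnt β c = q ∧ cnt τ c = p := fun c hc =>
    ⟨cnt_bot _ _ fun i => hc.trans (hα i).1, cnt_bot _ _ fun i => hc.trans (hβ i).1,
      cnt_bot _ _ fun i => hc.trans (hτ i).1⟩
  obtain ⟨t1, t2, t3⟩ := top hi le_rfl
  obtain ⟨b1, b2, b3⟩ := bot (hi - H) le_rfl
  simp only [t1, t2, t3, b1, b2, b3, sub_self, mul_zero, Nat.cast_zero] at h
  rw [h]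
  have key : ((∀ c ∈ Finset.Ico (hi - H) hi, adm (e * ((cnt τ c : ℤ) - cnt α c)) (e * ((cnt τ c : ℤ) - cnt β c))) ∧
      (True ∧ e * ((p : ℤ) - q) = 1)) ↔ (∀ c, adm (e * ((cnt τ c : ℤ) - cnt α c)) (e * ((cnt τ c : ℤ) - cnt β c))) := by
    constructor
    · rintro ⟨h1, -⟩ c
      by_cases hc : hi ≤ c
      · obtain ⟨t1, t2, t3⟩ := top c hc
        simp [t1, t2, t3, adm]
      by_cases hc' : c ≤ hi - H
      · obtain ⟨t1, t2, t3⟩ := bot c hc'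
        simp [t1, t2, t3, adm, he]
      exact h1 c (by simp; omega)
    · intro h1; exact ⟨fun c _ => h1 c, trivial, he⟩
  simp only [key]
  split_ifs with hc
  · rw [Finset.prod_mul_distrib, Finset.prod_pow_eq_pow_sum]
    congr 2
    zify
    have s1 := sum_cnt τ _ _ hτ
    have s2 := sum_cnt α _ _ hα
    have s3 : ∑ c ∈ Finset.Ico (hi - H) hi, (((e * ((cnt τ c : ℤ) - cnt α c)).toNat : ℕ) : ℤ) =
        e * (sumz τ - sumz α) := by
      rw [Finset.sum_congr rfl (g := fun c => e * ((cnt τ c : ℤ) - cnt α c))]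
      · rw [← Finset.mul_sum, Finset.sum_sub_distrib, s1, s2]; ring
      · intro c _
        have := (hc c).1
        rw [Int.toNat_of_nonneg]; omega
    rw [s3, Int.toNat_of_nonneg]
    rw [← s3]; positivity
  · rfl

lemma wt_sum_zero {R : Type} [CommRing R] (u : R) (e : ℤ) (w : ℕ → ℕ → ℕ → R) (H : ℕ) :
    ∀ (a b : ℕ → ℕ) (s : Fin H → ℕ) (h k : ℤ), wt u e w H a b s h k ≠ 0 →
      h + e * ((∑ j, (s j : ℤ)) - ∑ j ∈ Finset.range H, (a j : ℤ)) = 0 := by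
  induction H with
  | zero => intro a b s h k; simp [wt]; tauto
  | succ H ih =>
    intro a b s h k hne
    rw [wt] at hne
    split_ifs at hne with h1
    · have := ih _ _ _ _ _ (right_ne_zero_of_mul hne)
      rw [Fin.sum_univ_succ, Finset.sum_range_succ']
      linarith
    · simp at hne

lemma sum_mcount {p : ℕ} (l : Fin p → ℤ) (H : ℕ) : ∀ hi : ℤ,
    ∑ j ∈ Finset.range H, (mcount l (hi - 1 - j) : ℤ) = (cnt l (hi - H) : ℤ) - cnt l hi := by
  induction H with
  | zero => intro hi; simp
  | succ H ih =>
    intro hi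
    rw [Finset.sum_range_succ, ih]
    have := cnt_succ l (hi - 1 - H)
    have e : hi - 1 - H + 1 = hi - H := by ring
    rw [e] at this
    have e3 : hi - ((H + 1 : ℕ) : ℤ) = hi - 1 - H := by push_cast; ring
    rw [e3, this]; push_cast; ring

/-- signatures with values in the window. -/
def SigW (p : ℕ) (lo hi : ℤ) : Finset (Fin p → ℤ) :=
  (Fintype.piFinset fun _ => Finset.Ico lo hi).filter IsSig

lemma mem_SigW {p : ℕ} {lo hi : ℤ} {l : Fin p → ℤ} : l ∈ SigW p lo hi ↔ InW l lo hi ∧ IsSig l := by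
  simp [SigW, InW]

lemma sum_sig {R : Type} [CommRing R] (u : R) (e : ℤ) (he : e ≠ 0) (w : ℕ → ℕ → ℕ → R) {p : ℕ}
    (α : Fin p → ℤ) (b : ℕ → ℕ) (B : ℕ) (hB : p < B) (hi : ℤ) (H : ℕ)
    (hα : InW α (hi - H) hi) :
    ∑ τ ∈ SigW p (hi - H) hi, wt u e w H (fun j => mcount α (hi - 1 - j)) b
      (fun j => mcount τ (hi - 1 - (j : ℕ))) 0 0 =
    GG u e w B H (fun j => mcount α (hi - 1 - j)) b 0 0 := by
  rw [← sum_wt]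
  apply Finset.sum_of_injOn (fun τ j => ⟨mcount τ (hi - 1 - (j : ℕ)), (mcount_le _ _).trans_lt hB⟩)
  · intro τ hτ τ' hτ' hE
    have hτ := mem_SigW.1 hτ
    have hτ' := mem_SigW.1 hτ'
    apply sig_ext_mcount hτ.2 hτ'.2
    intro c
    by_cases hc : hi - H ≤ c ∧ c < hi
    · have := congrFun hE ⟨(hi - 1 - c).toNat, by omega⟩
      simp only [Fin.mk.injEq] at this
      have e : hi - 1 - ((hi - 1 - c).toNat : ℤ) = c := by omega
      rwa [e] at this
    · rw [mcount_out, mcount_out]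
      · intro i h; have := hτ'.1 i; omega
      · intro i h; have := hτ.1 i; omega
  · intro τ hτ; simp
  · intro s _ hs
    by_contra hne
    apply hs
    have h0 := wt_sum_zero _ _ _ _ _ _ _ _ _ hne
    rw [sum_mcount, cnt_bot _ _ (fun i => (hα i).1), cnt_top _ _ (fun i => (hα i).2)] at h0
    simp [he] at h0
    obtain ⟨τ, h1, h2⟩ := exists_sig (p := p)
      (∑ j : Fin H, Multiset.replicate (s j : ℕ) (hi - 1 - ((j : ℕ) : ℤ)))
      (by rw [Multiset.card_sum]; simp; zify; linarith)
    have hcount : ∀ c, mcount τ c = ∑ j : Fin H, if hi - 1 - ((j : ℕ) : ℤ) = c then (s j : ℕ) else 0 := by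
      intro c
      rw [h2, Multiset.count_sum']
      simp [Multiset.count_replicate]
    refine ⟨τ, ?_, ?_⟩
    · rw [Finset.mem_coe, mem_SigW]
      refine ⟨?_, h1⟩
      intro i
      by_contra hc
      have : mcount τ (τ i) = 0 := by
        rw [hcount]
        apply Finset.sum_eq_zero
        intro j _
        rw [if_neg]
        have := j.2
        omega
      unfold mcount at this
      rw [Finset.card_eq_zero, Finset.filter_eq_empty_iff] at this
      exact this (Finset.mem_univ i) rfl
    · ext j
      simp only
      rw [hcount, Finset.sum_eq_single j]
      · simp
      · intro k _ hk
        rw [if_neg]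
        intro h; apply hk; ext; omega
      · simp
  · intro τ _; rfl

lemma psi_prod {K : Type} [Field K] {p : ℕ} (t : K) (l : Fin (p + 1) → ℤ) (μ : Fin p → ℤ) (lo hi : ℤ)
    (hμ : InW μ lo hi) : psiHL t l μ = ∏ c ∈ Finset.Ico lo hi,
      if mcount μ c = mcount l c + 1 then 1 - t ^ mcount μ c else 1 := by
  unfold psiHL
  apply finprod_eq_prod_of_mulSupport_subset
  intro c hc
  by_contra hcc
  apply hc
  simp only
  rw [if_neg]
  rw [mcount_out μ c]
  · omega
  · intro i h; have := hμ i; simp at hcc; omega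

lemma phi_prod {K : Type} [Field K] {p : ℕ} (t : K) (l μ : Fin p → ℤ) (lo hi : ℤ)
    (hl : InW l lo hi) : phiHL t l μ = ∏ c ∈ Finset.Ico lo hi,
      if mcount l c = mcount μ c + 1 then 1 - t ^ mcount l c else 1 := by
  unfold phiHL
  apply finprod_eq_prod_of_mulSupport_subset
  intro c hc
  by_contra hcc
  apply hc
  simp only
  rw [if_neg]
  rw [mcount_out l c]
  · omega
  · intro i h; have := hl i; simp at hcc; omega

lemma Wloc_C {K : Type} [Field K] (t : K) (p q s : ℕ) :
    Wloc (Polynomial.C t) p q s = Polynomial.C (Wloc t p q s) := by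
  unfold Wloc; split_ifs <;> simp

lemma interQ_sumz {n : ℕ} {ν κ : Fin n → ℤ} (h : interQ ν κ) : sumz ν ≤ sumz κ :=
  Finset.sum_le_sum fun i _ => h.1 i

lemma adm_kap {n : ℕ} {ν κ : Fin (n + 1) → ℤ} {ρ : Fin n → ℤ} (hν : IsSig ν) (hκ : IsSig κ) (hρ : IsSig ρ) :
    (∀ c, adm (1 * ((cnt κ c : ℤ) - cnt ν c)) (1 * ((cnt κ c : ℤ) - cnt ρ c))) ↔ interQ ν κ ∧ interP ρ κ := by
  rw [interQ_iff hν hκ, interP_iff hρ hκ, ← forall_and]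
  apply forall_congr'
  intro c
  unfold adm
  omega

lemma adm_sig {n : ℕ} {ν : Fin (n + 1) → ℤ} {ρ σ : Fin n → ℤ} (hν : IsSig ν) (hσ : IsSig σ) (hρ : IsSig ρ) :
    (∀ c, adm (-1 * ((cnt σ c : ℤ) - cnt ρ c)) (-1 * ((cnt σ c : ℤ) - cnt ν c))) ↔ interP σ ν ∧ interQ σ ρ := by
  rw [interQ_iff hσ hρ, interP_iff hσ hν, ← forall_and]
  apply forall_congr'
  intro c
  unfold adm
  omega

lemma kap_side {K : Type} [Field K] (t : K) {n : ℕ} (ν : Fin (n + 1) → ℤ) (ρ : Fin n → ℤ)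
    (hν : IsSig ν) (hρ : IsSig ρ) (hi : ℤ) (H : ℕ) (wν : InW ν (hi - H) hi) (wρ : InW ρ (hi - H) hi) :
    GG (Polynomial.X : Polynomial K) 1 (Wloc (Polynomial.C t)) (n + 3) H
      (fun j => mcount ν (hi - 1 - j)) (fun j => mcount ρ (hi - 1 - j)) 0 0 =
    ∑ κ ∈ SigW (n + 1) (hi - H) hi, if interQ ν κ ∧ interP ρ κ then
      Polynomial.C (phiHL t κ ν * psiHL t κ ρ) * Polynomial.X ^ (sumz κ - sumz ν).toNat else 0 := by
  rw [← sum_sig _ _ one_ne_zero _ _ _ (n + 3) (by omega) _ _ wν]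
  refine Finset.sum_congr rfl fun κ hκ => ?_
  rw [mem_SigW] at hκ
  rw [wt_sig _ _ _ _ _ _ _ _ wν wρ hκ.1 (by push_cast; ring)]
  simp only [adm_kap hν hκ.2 hρ]
  rw [phi_prod t κ ν _ _ hκ.1, psi_prod t κ ρ _ _ wρ, ← Finset.prod_mul_distrib, map_prod]
  simp only [Wloc_C, one_mul]
  rfl

lemma sig_side {K : Type} [Field K] (t : K) {n : ℕ} (ν : Fin (n + 1) → ℤ) (ρ : Fin n → ℤ)
    (hν : IsSig ν) (hρ : IsSig ρ) (hi : ℤ) (H : ℕ) (wν : InW ν (hi - H) hi) (wρ : InW ρ (hi - H) hi) :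
    GG (Polynomial.X : Polynomial K) (-1) (fun a b s => Wloc (Polynomial.C t) b a s) (n + 3) H
      (fun j => mcount ρ (hi - 1 - j)) (fun j => mcount ν (hi - 1 - j)) 0 0 =
    ∑ σ ∈ SigW n (hi - H) hi, if interP σ ν ∧ interQ σ ρ then
      Polynomial.C (psiHL t ν σ * phiHL t ρ σ) * Polynomial.X ^ (sumz ρ - sumz σ).toNat else 0 := by
  rw [← sum_sig _ _ (by norm_num) _ _ _ (n + 3) (by omega) _ _ wρ]
  refine Finset.sum_congr rfl fun σ hσ => ?_
  rw [mem_SigW] at hσ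
  rw [wt_sig _ _ _ _ _ _ _ _ wρ wν hσ.1 (by push_cast; ring)]
  simp only [adm_sig hν hσ.2 hρ]
  rw [psi_prod t ν σ _ _ hσ.1, phi_prod t ρ σ _ _ wρ, ← Finset.prod_mul_distrib, map_prod]
  simp only [Wloc_C]
  rw [show -1 * (sumz σ - sumz ρ) = sumz ρ - sumz σ by ring]
  rfl

/-- left local sum -/
def Lsum {K : Type} [Field K] (t : K) {n : ℕ} (lo hi : ℤ) (ν : Fin (n + 1) → ℤ) (ρ : Fin n → ℤ) (d : ℕ) : K :=
  ∑ κ ∈ SigW (n + 1) lo hi, if (interQ ν κ ∧ sumz κ = sumz ν + d) ∧ interP ρ κ then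
    phiHL t κ ν * psiHL t κ ρ else 0

/-- right local sum -/
def Rsum {K : Type} [Field K] (t : K) {n : ℕ} (lo hi : ℤ) (ν : Fin (n + 1) → ℤ) (ρ : Fin n → ℤ) (d : ℕ) : K :=
  ∑ σ ∈ SigW n lo hi, if interP σ ν ∧ (interQ σ ρ ∧ sumz ρ = sumz σ + d) then
    psiHL t ν σ * phiHL t ρ σ else 0

lemma kap_coeff {K : Type} [Field K] (t : K) {n : ℕ} (ν : Fin (n + 1) → ℤ) (ρ : Fin n → ℤ)
    (lo hi : ℤ) (d : ℕ) :
    (∑ κ ∈ SigW (n + 1) lo hi, if interQ ν κ ∧ interP ρ κ then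
      Polynomial.C (phiHL t κ ν * psiHL t κ ρ) * Polynomial.X ^ (sumz κ - sumz ν).toNat else 0).coeff d
    = Lsum t lo hi ν ρ d := by
  rw [Polynomial.finset_sum_coeff, Lsum]
  refine Finset.sum_congr rfl fun κ _ => ?_
  by_cases h : interQ ν κ ∧ interP ρ κ
  · have := interQ_sumz h.1
    rw [if_pos h, Polynomial.coeff_C_mul_X_pow]
    apply if_congr _ rfl rfl
    simp only [h, true_and, and_true]; omega
  · rw [if_neg h, if_neg (by tauto)]; simp

lemma sig_coeff {K : Type} [Field K] (t : K) {n : ℕ} (ν : Fin (n + 1) → ℤ) (ρ : Fin n → ℤ)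
    (lo hi : ℤ) (d : ℕ) :
    (∑ σ ∈ SigW n lo hi, if interP σ ν ∧ interQ σ ρ then
      Polynomial.C (psiHL t ν σ * phiHL t ρ σ) * Polynomial.X ^ (sumz ρ - sumz σ).toNat else 0).coeff d
    = Rsum t lo hi ν ρ d := by
  rw [Polynomial.finset_sum_coeff, Rsum]
  refine Finset.sum_congr rfl fun σ _ => ?_
  by_cases h : interP σ ν ∧ interQ σ ρ
  · have := interQ_sumz h.2
    rw [if_pos h, Polynomial.coeff_C_mul_X_pow]
    apply if_congr _ rfl rfl
    simp only [h, true_and]; omega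
  · rw [if_neg h, if_neg (by tauto)]; simp

lemma interQ_bd {n : ℕ} {ν κ : Fin n → ℤ} (h : interQ ν κ) (d : ℕ) (hs : sumz κ = sumz ν + d) (i : Fin n) :
    κ i ≤ ν i + d := by
  have h1 : ∑ j, (κ j - ν j) = d := by
    rw [Finset.sum_sub_distrib]; unfold sumz at hs; omega
  have := Finset.single_le_sum (f := fun j => κ j - ν j) (s := Finset.univ)
    (fun j _ => by have := h.1 j; omega) (Finset.mem_univ i)
  omega

lemma SigW_mono {n : ℕ} {lo hi hi' : ℤ} (h : hi ≤ hi') : SigW n lo hi ⊆ SigW n lo hi' := by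
  intro l hl
  rw [mem_SigW] at *
  exact ⟨fun i => ⟨(hl.1 i).1, (hl.1 i).2.trans_le h⟩, hl.2⟩

lemma Lsum_win {K : Type} [Field K] (t : K) {n : ℕ} (ν : Fin (n + 1) → ℤ) (ρ : Fin n → ℤ)
    (lo hi hi' : ℤ) (h : hi ≤ hi') (d : ℕ) (wν : InW ν lo (hi - d)) :
    Lsum t lo hi ν ρ d = Lsum t lo hi' ν ρ d := by
  unfold Lsum
  apply Finset.sum_subset (SigW_mono h)
  intro κ hκ hn
  rw [if_neg]
  rintro ⟨⟨h1, h2⟩, -⟩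
  apply hn
  rw [mem_SigW] at *
  refine ⟨fun i => ?_, hκ.2⟩
  have a := interQ_bd h1 d h2 i
  have b := hκ.1 i
  have c := wν i
  omega

lemma Rsum_win {K : Type} [Field K] (t : K) {n : ℕ} (ν : Fin (n + 1) → ℤ) (ρ : Fin n → ℤ)
    (lo hi hi' : ℤ) (h : hi ≤ hi') (d : ℕ) (wν : InW ν lo hi) :
    Rsum t lo hi ν ρ d = Rsum t lo hi' ν ρ d := by
  unfold Rsum
  apply Finset.sum_subset (SigW_mono h)
  intro κ hκ hn
  rw [if_neg]
  rintro ⟨h1, -⟩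
  apply hn
  rw [mem_SigW] at *
  refine ⟨fun i => ?_, hκ.2⟩
  have b := hκ.1 i
  have c := wν i.castSucc
  have := h1 i
  omega

lemma local_id {K : Type} [Field K] (t : K) {n : ℕ} (ν : Fin (n + 1) → ℤ) (ρ : Fin n → ℤ)
    (hν : IsSig ν) (hρ : IsSig ρ) (lo hi : ℤ) (d : ℕ) (wν : InW ν lo (hi - d)) (wρ : InW ρ lo hi) :
    Lsum t lo hi ν ρ d - (if d = 0 then 0 else Lsum t lo hi ν ρ (d - 1)) =
    Rsum t lo hi ν ρ d - t * (if d = 0 then 0 else Rsum t lo hi ν ρ (d - 1)) := by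
  have wν1 : InW ν lo hi := fun i => ⟨(wν i).1, by have := (wν i).2; omega⟩
  have hlt : lo < hi := by have := wν1 0; omega
  set M := (hi - lo).toNat with hM
  set N := d + 1 with hN
  have hlo : (hi + N) - ((N + M : ℕ) : ℤ) = lo := by push_cast; omega
  have mono : ∀ {p : ℕ} {l : Fin p → ℤ}, InW l lo hi → InW l ((hi + N) - ((N + M : ℕ) : ℤ)) (hi + N) := by
    intro p l hl i; have := hl i; rw [hlo]; omega
  have rel := (gg_rel (Polynomial.C t) (Polynomial.X : Polynomial K) (n + 3) (N + M)
    (fun j => mcount ν (hi + N - 1 - j)) (fun j => mcount ρ (hi + N - 1 - j))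
    (fun j => by have := mcount_le ν (hi + N - 1 - j); omega)
    (fun j => by have := mcount_le ρ (hi + N - 1 - j); omega)).X
  obtain ⟨y, hy⟩ := gg_pad (Polynomial.C t) (Polynomial.X : Polynomial K) (n + 3) M N (by omega)
    (fun j => mcount ν (hi + N - 1 - j)) (fun j => mcount ρ (hi + N - 1 - j))
    (fun j hj => mcount_out _ _ fun i h => by have := wν1 i; omega)
    (fun j hj => mcount_out _ _ fun i h => by have := wρ i; omega)
  rw [hy, kap_side t ν ρ hν hρ _ _ (mono wν1) (mono wρ), sig_side t ν ρ hν hρ _ _ (mono wν1) (mono wρ), hlo] at rel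
  have cf := congrArg (fun p => Polynomial.coeff p d) rel
  set F := ∑ κ ∈ SigW (n + 1) lo (hi + N), if interQ ν κ ∧ interP ρ κ then
      Polynomial.C (phiHL t κ ν * psiHL t κ ρ) * Polynomial.X ^ (sumz κ - sumz ν).toNat else 0 with hF
  set G := ∑ σ ∈ SigW n lo (hi + N), if interP σ ν ∧ interQ σ ρ then
      Polynomial.C (psiHL t ν σ * phiHL t ρ σ) * Polynomial.X ^ (sumz ρ - sumz σ).toNat else 0 with hG
  have r1 : (1 - Polynomial.C t * Polynomial.X) * G = G - Polynomial.C t * (G * Polynomial.X) := by ring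
  have r2 : (1 - Polynomial.X) * F + (1 - Polynomial.C t) * Polynomial.X * (Polynomial.X ^ N * y) =
    F - F * Polynomial.X + ((1 - Polynomial.C t) * Polynomial.X * y) * Polynomial.X ^ N := by ring
  have r3 : (((1 - Polynomial.C t) * Polynomial.X * y) * Polynomial.X ^ N).coeff d = 0 := by
    rw [Polynomial.coeff_mul_X_pow', if_neg (by omega)]
  rw [r1, r2, Polynomial.coeff_add, r3, add_zero, Polynomial.coeff_sub, Polynomial.coeff_sub,
    Polynomial.coeff_C_mul] at cf
  rcases d with _ | d
  · simp only [Polynomial.coeff_mul_X_zero, hF, hG, kap_coeff, sig_coeff] at cf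
    rw [← Lsum_win t ν ρ lo hi _ (by omega) 0 wν, ← Rsum_win t ν ρ lo hi _ (by omega) 0 wν1] at cf
    simp only [if_true]
    exact cf.symm
  · simp only [Polynomial.coeff_mul_X, hF, hG, kap_coeff, sig_coeff] at cf
    rw [← Lsum_win t ν ρ lo hi _ (by omega) (d + 1) wν, ← Rsum_win t ν ρ lo hi _ (by omega) (d + 1) wν1,
      ← Lsum_win t ν ρ lo hi _ (by omega) d (fun i => ⟨(wν i).1, by have := (wν i).2; push_cast at this; omega⟩), ← Rsum_win t ν ρ lo hi _ (by omega) d wν1] at cf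
    simp
    exact cf.symm

/-- tuples interlacing below `l`. -/
def Dn {n : ℕ} (l : Fin (n + 1) → ℤ) : Finset (Fin n → ℤ) :=
  Fintype.piFinset fun i => Finset.Icc (l i.succ) (l i.castSucc)

lemma mem_Dn {n : ℕ} {l : Fin (n + 1) → ℤ} {ν : Fin n → ℤ} : ν ∈ Dn l ↔ interP ν l := by
  simp [Dn, interP, and_comm]

/-- Hall-Littlewood polynomial by branching -/
def Pn {K : Type} [Field K] (t : K) : (n : ℕ) → (Fin n → ℤ) → (Fin n → K) → K
  | 0, _, _ => 1
  | n + 1, l, x => ∑ ν ∈ Dn l, psiHL t l ν * x (Fin.last n) ^ (sumz l - sumz ν) *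
      Pn t n ν (fun i => x i.castSucc)

lemma HLP_step {K : Type} [Field K] (t y : K) {p q : ℕ} (h : p = q) (l : Fin (p + 1) → ℤ)
    (F : (Fin p → ℤ) → K) :
    (∑ᶠ ν : Fin p → ℤ, if interP ν l then psiHL t l ν * y ^ (sumz l - sumz ν) * F ν else 0) =
    ∑ ν ∈ Dn (fun i : Fin (q + 1) => l (Fin.cast (by rw [h]) i)),
      psiHL t (fun i : Fin (q + 1) => l (Fin.cast (by rw [h]) i)) ν *
        y ^ (sumz (fun i : Fin (q + 1) => l (Fin.cast (by rw [h]) i)) - sumz ν) *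
        F (fun i => ν (Fin.cast h i)) := by
  subst h
  simp only [Fin.cast_eq_self]
  rw [finsum_eq_sum_of_support_subset (s := Dn l)]
  · refine Finset.sum_congr rfl fun ν hν => ?_
    rw [if_pos (mem_Dn.1 hν)]
  · intro ν hν
    rw [Finset.mem_coe, mem_Dn]
    by_contra hc
    apply hν
    simp only
    rw [if_neg hc]

lemma HLP_eq {K : Type} [Field K] (t : K) (k : ℕ) : ∀ (μ : Fin 0 → ℤ) (l : Fin (0 + k) → ℤ) (x : Fin k → K),
    HLP t k μ l x = Pn t k (fun i => l (Fin.cast (Nat.zero_add k).symm i)) x := by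
  induction k with
  | zero =>
    intro μ l x
    rw [HLP, Pn, if_pos (by ext i; exact i.elim0)]
  | succ k ih =>
    intro μ l x
    rw [HLP]
    simp only [ih]
    refine (HLP_step t (x (Fin.last k)) (Nat.zero_add k) l _).trans ?_
    rw [Pn]
    rfl

lemma HLPfull_eq {K : Type} [Field K] {n : ℕ} (t : K) (l : Fin n → ℤ) (x : Fin n → K) :
    HLPfull t l x = Pn t n l x := by
  rw [HLPfull, HLP_eq]
  rfl

lemma interP_sig {n : ℕ} {l : Fin (n + 1) → ℤ} {ν : Fin n → ℤ} (hl : IsSig l) (h : interP ν l) : IsSig ν := by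
  intro i j hij
  rcases eq_or_lt_of_le hij with rfl | hij
  · exact le_rfl
  · have a := (h j).1
    have b := (h i).2
    have := hl i.succ j.castSucc (by simp [Fin.le_def]; omega)
    omega

lemma interP_win {n : ℕ} {l : Fin (n + 1) → ℤ} {ν : Fin n → ℤ} {lo hi : ℤ} (hl : InW l lo hi) (h : interP ν l) :
    InW ν lo hi := by
  intro i
  have a := h i
  have b := hl i.succ
  have c := hl i.castSucc
  omega

lemma Pn_win {K : Type} [Field K] (t : K) {n : ℕ} (l : Fin (n + 1) → ℤ) (x : Fin (n + 1) → K) (lo hi : ℤ)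
    (hl : IsSig l) (wl : InW l lo hi) :
    Pn t (n + 1) l x = ∑ ρ ∈ SigW n lo hi, if interP ρ l then psiHL t l ρ * x (Fin.last n) ^ (sumz l - sumz ρ) *
      Pn t n ρ (fun i => x i.castSucc) else 0 := by
  rw [Pn, ← Finset.sum_filter]
  apply Finset.sum_congr _ (fun _ _ => rfl)
  ext ρ
  rw [mem_Dn, Finset.mem_filter, mem_SigW]
  exact ⟨fun h => ⟨⟨interP_win wl h, interP_sig hl h⟩, h⟩, fun h => h.2⟩

/-- generating series -/
def gser {K : Type} [Field K] (t : K) {n : ℕ} (x : Fin n → K) : PowerSeries K :=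
  ∏ i, ((1 - PowerSeries.C (t * x i) * PowerSeries.X) * PowerSeries.mk (fun d => x i ^ d))

lemma geom_inv {K : Type} [Field K] (y : K) :
    (1 - PowerSeries.C y * PowerSeries.X) * PowerSeries.mk (fun d => y ^ d) = 1 := by
  ext d
  rw [sub_mul, one_mul, mul_assoc, map_sub, PowerSeries.coeff_C_mul]
  rcases d with _ | d
  · simp
  · rw [PowerSeries.coeff_succ_X_mul]
    simp [PowerSeries.coeff_one, pow_succ]; ring

lemma gser_rec {K : Type} [Field K] (t : K) {n : ℕ} (x : Fin (n + 1) → K) (d : ℕ) :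
    PowerSeries.coeff d (gser t x) - x (Fin.last n) * (if d = 0 then 0 else PowerSeries.coeff (d - 1) (gser t x)) =
    PowerSeries.coeff d (gser t (fun i => x i.castSucc)) - t * x (Fin.last n) *
      (if d = 0 then 0 else PowerSeries.coeff (d - 1) (gser t (fun i => x i.castSucc))) := by
  have h : (1 - PowerSeries.C (x (Fin.last n)) * PowerSeries.X) * gser t x =
    (1 - PowerSeries.C (t * x (Fin.last n)) * PowerSeries.X) * gser t (fun i => x i.castSucc) := by
    unfold gser
    rw [Fin.prod_univ_castSucc]
    have := geom_inv (x (Fin.last n))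
    linear_combination ((1 - PowerSeries.C (t * x (Fin.last n)) * PowerSeries.X) * ∏ i : Fin n,
      ((1 - PowerSeries.C (t * x i.castSucc) * PowerSeries.X) * PowerSeries.mk (fun d => x i.castSucc ^ d))) * this
  have h2 := congrArg (PowerSeries.coeff d) h
  rw [sub_mul, one_mul, mul_assoc, map_sub, PowerSeries.coeff_C_mul, sub_mul, one_mul, mul_assoc, map_sub,
    PowerSeries.coeff_C_mul] at h2
  rcases d with _ | d
  · simpa using h2
  · rw [PowerSeries.coeff_succ_X_mul, PowerSeries.coeff_succ_X_mul] at h2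
    simpa using h2

lemma D_eq {K : Type} [Field K] (t : K) {n : ℕ} (ν : Fin (n + 1) → ℤ) (x : Fin (n + 1) → K)
    (lo hi : ℤ) (d : ℕ) :
    (∑ κ ∈ SigW (n + 1) lo hi, if interQ ν κ ∧ sumz κ = sumz ν + d then phiHL t κ ν * Pn t (n + 1) κ x else 0) =
    ∑ ρ ∈ SigW n lo hi, x (Fin.last n) ^ (sumz ν + d - sumz ρ) * Pn t n ρ (fun i => x i.castSucc) *
      Lsum t lo hi ν ρ d := by
  simp only [Lsum, Finset.mul_sum]
  rw [Finset.sum_comm]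
  refine Finset.sum_congr rfl fun κ hκ => ?_
  rw [mem_SigW] at hκ
  by_cases h : interQ ν κ ∧ sumz κ = sumz ν + d
  · rw [if_pos h, Pn_win t κ x lo hi hκ.2 hκ.1, Finset.mul_sum]
    refine Finset.sum_congr rfl fun ρ _ => ?_
    by_cases h2 : interP ρ κ
    · rw [if_pos h2, if_pos ⟨h, h2⟩, h.2]; ring
    · rw [if_neg h2, if_neg (by tauto)]; ring
  · rw [if_neg h]
    symm
    apply Finset.sum_eq_zero
    intro ρ _
    rw [if_neg (by tauto), mul_zero]

lemma R_eq {K : Type} [Field K] (t : K) {n : ℕ} (ν : Fin (n + 1) → ℤ) (hν : IsSig ν) (x : Fin (n + 1) → K)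
    (lo hi : ℤ) (d : ℕ) (wν : InW ν lo (hi - d)) (g : K)
    (ih : ∀ (σ : Fin n → ℤ), IsSig σ → InW σ lo (hi - d) →
      (∑ κ ∈ SigW n lo hi, if interQ σ κ ∧ sumz κ = sumz σ + d then
        phiHL t κ σ * Pn t n κ (fun i => x i.castSucc) else 0) = Pn t n σ (fun i => x i.castSucc) * g) :
    ∑ ρ ∈ SigW n lo hi, x (Fin.last n) ^ (sumz ν + d - sumz ρ) * Pn t n ρ (fun i => x i.castSucc) *
      Rsum t lo hi ν ρ d = Pn t (n + 1) ν x * g := by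
  simp only [Rsum, Finset.mul_sum]
  rw [Finset.sum_comm, Pn_win t ν x lo hi hν (fun i => ⟨(wν i).1, by have := (wν i).2; omega⟩), Finset.sum_mul]
  refine Finset.sum_congr rfl fun σ hσ => ?_
  rw [mem_SigW] at hσ
  by_cases h : interP σ ν
  · rw [if_pos h, mul_assoc, ← ih σ hσ.2 (interP_win wν h), Finset.mul_sum]
    refine Finset.sum_congr rfl fun ρ _ => ?_
    by_cases h2 : interQ σ ρ ∧ sumz ρ = sumz σ + d
    · rw [if_pos h2, if_pos ⟨h, h2⟩, h2.2]
      rw [show sumz ν + d - (sumz σ + d) = sumz ν - sumz σ by ring]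
      ring
    · rw [if_neg h2, if_neg (by tauto)]; ring
  · rw [if_neg h, zero_mul]
    apply Finset.sum_eq_zero
    intro ρ _
    rw [if_neg (by tauto), mul_zero]

lemma pieri {K : Type} [Field K] (t : K) (n : ℕ) : ∀ (ν : Fin n → ℤ) (_ : IsSig ν) (x : Fin n → K)
    (_ : ∀ i, x i ≠ 0) (lo hi : ℤ) (d : ℕ) (_ : InW ν lo (hi - d)),
    (∑ κ ∈ SigW n lo hi, if interQ ν κ ∧ sumz κ = sumz ν + d then phiHL t κ ν * Pn t n κ x else 0) =
      Pn t n ν x * PowerSeries.coeff d (gser t x) := by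
  induction n with
  | zero =>
    intro ν _ x _ lo hi d _
    have h1 : SigW 0 lo hi = {ν} := by
      ext l; rw [mem_SigW]; simp [InW, IsSig]; exact Subsingleton.elim _ _
    rw [h1, Finset.sum_singleton]
    have h2 : phiHL t ν ν = 1 := by
      unfold phiHL; simp
    simp [h2, Pn, gser, PowerSeries.coeff_one, interQ, sumz]
    congr 1; simp [eq_comm]
  | succ n ih =>
    intro ν hν x hx lo hi d
    have key : ∀ ρ ∈ SigW n lo hi, InW ν lo (hi - d) → Lsum t lo hi ν ρ d = Rsum t lo hi ν ρ d -
        t * (if d = 0 then 0 else Rsum t lo hi ν ρ (d - 1)) + (if d = 0 then 0 else Lsum t lo hi ν ρ (d - 1)) := by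
      intro ρ hρ wν
      rw [mem_SigW] at hρ
      have := local_id t ν ρ hν hρ.2 lo hi d wν hρ.1
      linear_combination this
    have hg := gser_rec t x d
    have hy := hx (Fin.last n)
    induction d with
    | zero =>
      intro wν
      have hR := R_eq t ν hν x lo hi 0 wν _ (fun σ h1 h2 => ih σ h1 _ (fun i => hx _) lo hi 0 h2)
      rw [D_eq]
      simp only [if_true, mul_zero, sub_zero] at hg
      rw [hg, ← hR]
      refine Finset.sum_congr rfl fun ρ hρ => ?_
      rw [key ρ hρ wν]; simp
    | succ d ihd =>
      intro wν
      have wν' : InW ν lo (hi - d) := fun i => ⟨(wν i).1, by have := (wν i).2; push_cast at this; omega⟩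
      have hR := R_eq t ν hν x lo hi (d + 1) wν _ (fun σ h1 h2 => ih σ h1 _ (fun i => hx _) lo hi (d + 1) h2)
      have hR' := R_eq t ν hν x lo hi d wν' _ (fun σ h1 h2 => ih σ h1 _ (fun i => hx _) lo hi d h2)
      have hL := ihd (fun ρ hρ w => by
        rw [mem_SigW] at hρ
        have := local_id t ν ρ hν hρ.2 lo hi d w hρ.1
        linear_combination this) (gser_rec t x d) wν'
      rw [D_eq] at hL ⊢
      simp only [Nat.add_eq_zero_iff, one_ne_zero, and_false, if_false, Nat.add_sub_cancel] at hg key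
      have hg' : PowerSeries.coeff (d + 1) (gser t x) = PowerSeries.coeff (d + 1) (gser t fun i => x i.castSucc) -
        t * x (Fin.last n) * PowerSeries.coeff d (gser t fun i => x i.castSucc) +
        x (Fin.last n) * PowerSeries.coeff d (gser t x) := by linear_combination hg
      have e : Pn t (n + 1) ν x * PowerSeries.coeff (d + 1) (gser t x) =
        Pn t (n + 1) ν x * PowerSeries.coeff (d + 1) (gser t fun i => x i.castSucc) -
        t * x (Fin.last n) * (Pn t (n + 1) ν x * PowerSeries.coeff d (gser t fun i => x i.castSucc)) +
        x (Fin.last n) * (Pn t (n + 1) ν x * PowerSeries.coeff d (gser t x)) := by rw [hg']; ring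
      rw [e, ← hR, ← hR', ← hL, Finset.mul_sum, Finset.mul_sum, ← Finset.sum_sub_distrib, ← Finset.sum_add_distrib]
      refine Finset.sum_congr rfl fun ρ hρ => ?_
      rw [key ρ hρ wν]
      have e2 : x (Fin.last n) ^ (sumz ν + ((d + 1 : ℕ) : ℤ) - sumz ρ) =
          x (Fin.last n) ^ (sumz ν + (d : ℤ) - sumz ρ) * x (Fin.last n) := by
        rw [← zpow_add_one₀ hy]; congr 1; push_cast; ring
      rw [e2]; ring

lemma interQ_sig {n : ℕ} {κ l : Fin n → ℤ} (hκ : IsSig κ) (h : interQ κ l) : IsSig l := by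
  intro i j hij
  rcases eq_or_lt_of_le hij with rfl | hij
  · exact le_rfl
  · have a := h.2 ⟨(j : ℕ) - 1, by omega⟩ j (by simp; omega)
    have b := hκ i ⟨(j : ℕ) - 1, by omega⟩ (by simp [Fin.le_def]; omega)
    have := h.1 i
    omega

lemma HLQ_supp {K : Type} [Field K] {n : ℕ} (t : K) (k : ℕ) : ∀ (ν κ : Fin n → ℤ) (y : Fin k → K),
    IsSig ν → HLQ t k ν κ y ≠ 0 → IsSig κ ∧ ∀ i, ν i ≤ κ i := by
  induction k with
  | zero =>
    intro ν κ y hν h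
    rw [HLQ] at h
    split_ifs at h with h1
    · subst h1; exact ⟨hν, fun i => le_rfl⟩
    · simp at h
  | succ k ih =>
    intro ν l y hν h
    rw [HLQ] at h
    have hex : ∃ κ : Fin n → ℤ, (if interQ κ l then phiHL t l κ * y (Fin.last k) ^ (sumz l - sumz κ) *
        HLQ t k ν κ (fun i => y i.castSucc) else 0) ≠ 0 := by
      by_contra hc
      push Not at hc
      exact h (finsum_eq_zero_of_forall_eq_zero hc)
    obtain ⟨κ, hκ⟩ := hex
    split_ifs at hκ with h1
    · have := ih ν κ _ hν (right_ne_zero_of_mul hκ)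
      exact ⟨interQ_sig this.1 h1, fun i => (this.2 i).trans (h1.1 i)⟩
    · simp at hκ

lemma HLQ_win {K : Type} [Field K] {n : ℕ} (t : K) (k : ℕ) (ν l : Fin n → ℤ) (y : Fin (k + 1) → K)
    (lo hi : ℤ) (hν : IsSig ν) (wν : InW ν lo hi) (wl : InW l lo hi) :
    HLQ t (k + 1) ν l y = ∑ κ ∈ SigW n lo hi, if interQ κ l then
        phiHL t l κ * y (Fin.last k) ^ (sumz l - sumz κ) * HLQ t k ν κ fun i => y i.castSucc
      else 0 := by
  rw [HLQ]
  apply finsum_eq_sum_of_support_subset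
  intro κ hκ
  rw [Function.mem_support] at hκ
  split_ifs at hκ with h1
  · have := HLQ_supp _ _ _ _ _ hν (right_ne_zero_of_mul hκ)
    rw [Finset.mem_coe, mem_SigW]
    refine ⟨fun i => ?_, this.1⟩
    have a := this.2 i
    have b := h1.1 i
    have c := wν i
    have d := wl i
    omega
  · simp at hκ

lemma sum_bd {n : ℕ} {ν κ : Fin n → ℤ} (h : ∀ i, ν i ≤ κ i) (d : ℕ) (hs : sumz κ = sumz ν + d) (i : Fin n) :
    κ i ≤ ν i + d := by
  have h1 : ∑ j, (κ j - ν j) = d := by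
    rw [Finset.sum_sub_distrib]; unfold sumz at hs; omega
  have := Finset.single_le_sum (f := fun j => κ j - ν j) (s := Finset.univ)
    (fun j _ => by have := h j; omega) (Finset.mem_univ i)
  omega

lemma antidiag_sum {K : Type} [Field K] (d : ℕ) (A B L : ℤ) (h1 : A ≤ B) (h2 : B ≤ L) (f : ℕ → K) :
    ∑ p ∈ Finset.HasAntidiagonal.antidiagonal d, (if B = A + p.1 then (if L = B + p.2 then f p.2 else 0) else 0) =
    if L = A + d then f (L - B).toNat else 0 := by
  split_ifs with h
  · rw [Finset.sum_eq_single ((B - A).toNat, (L - B).toNat)]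
    · rw [if_pos (by simp; omega), if_pos (by simp; omega)]
    · rintro ⟨a, b⟩ _ hne
      split_ifs with h3 h4
      · exfalso; apply hne; simp only at h3 h4; ext <;> simp <;> omega
      · rfl
      · rfl
    · intro h3; exfalso; apply h3; simp; omega
  · apply Finset.sum_eq_zero
    rintro ⟨a, b⟩ hab
    simp at hab
    split_ifs with h3 h4
    · exfalso; apply h; simp at h3 h4; omega
    · rfl
    · rfl

lemma cauchy {K : Type} [Field K] (t : K) (n : ℕ) (ν : Fin n → ℤ) (hν : IsSig ν) (x : Fin n → K)
    (hx : ∀ i, x i ≠ 0) (lo hi : ℤ) (k : ℕ) : ∀ (y : Fin k → K) (d : ℕ) (_ : InW ν lo (hi - d)),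
    (∑ κ ∈ SigW n lo hi, if sumz κ = sumz ν + d then HLQ t k ν κ y * Pn t n κ x else 0) =
      Pn t n ν x * PowerSeries.coeff d (∏ j, PowerSeries.rescale (y j) (gser t x)) := by
  induction k with
  | zero =>
    intro y d wν
    rw [Finset.sum_eq_single ν]
    · simp [HLQ, PowerSeries.coeff_one]
    · intro κ _ hne
      simp [HLQ, hne.symm]
    · intro h; exfalso; apply h
      rw [mem_SigW]
      exact ⟨fun i => ⟨(wν i).1, by have := (wν i).2; omega⟩, hν⟩
  | succ k ih =>
    intro y d wν
    have wν0 : InW ν lo hi := fun i => ⟨(wν i).1, by have := (wν i).2; omega⟩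
    rw [Fin.prod_univ_castSucc, PowerSeries.coeff_mul, Finset.mul_sum]
    have step : ∀ p ∈ Finset.HasAntidiagonal.antidiagonal d,
        Pn t n ν x * (PowerSeries.coeff p.1 (∏ j : Fin k, PowerSeries.rescale (y j.castSucc) (gser t x)) *
          PowerSeries.coeff p.2 (PowerSeries.rescale (y (Fin.last k)) (gser t x))) =
        ∑ l ∈ SigW n lo hi, ∑ κ ∈ SigW n lo hi, (HLQ t k ν κ (fun i => y i.castSucc) *
          (if interQ κ l then phiHL t l κ * Pn t n l x else 0)) * (if sumz κ = sumz ν + p.1 then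
            (if sumz l = sumz κ + p.2 then y (Fin.last k) ^ p.2 else 0) else 0) := by
      rintro ⟨a, b⟩ hab
      simp at hab
      have wa : InW ν lo (hi - a) := fun i => ⟨(wν i).1, by have := (wν i).2; omega⟩
      rw [← mul_assoc, ← ih (fun j => y j.castSucc) a wa, PowerSeries.coeff_rescale, Finset.sum_mul, Finset.sum_comm]
      refine Finset.sum_congr rfl fun κ hκ => ?_
      simp only
      by_cases h1 : sumz κ = sumz ν + a
      · simp only [h1, if_true]
        by_cases h0 : HLQ t k ν κ (fun i => y i.castSucc) = 0
        · simp [h0]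
        have hs := HLQ_supp _ _ _ _ _ hν h0
        have hp := pieri t n κ hs.1 x hx lo hi b (fun i => by
          have := sum_bd hs.2 a h1 i
          have q1 := wν i
          have q2 := hs.2 i
          omega)
        rw [h1] at hp
        rw [mul_assoc, mul_left_comm (Pn t n κ x), ← hp, Finset.mul_sum, Finset.mul_sum]
        refine Finset.sum_congr rfl fun l _ => ?_
        by_cases h2 : interQ κ l
        · by_cases h3 : sumz l = sumz ν + a + b
          · simp only [h2, h3, and_self, if_true]
            ring
          · simp only [h2, h3, and_false, if_false]
            ring
        · simp [h2]
      · simp [h1]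
    rw [Finset.sum_congr rfl step, Finset.sum_comm]
    refine Finset.sum_congr rfl fun l hl => ?_
    rw [mem_SigW] at hl
    rw [Finset.sum_comm, HLQ_win t k ν l y lo hi hν wν0 hl.1]
    have fin : ∀ κ ∈ SigW n lo hi, (∑ p ∈ Finset.HasAntidiagonal.antidiagonal d, (HLQ t k ν κ (fun i => y i.castSucc) *
          (if interQ κ l then phiHL t l κ * Pn t n l x else 0)) * (if sumz κ = sumz ν + p.1 then
            (if sumz l = sumz κ + p.2 then y (Fin.last k) ^ p.2 else 0) else 0)) =
        if sumz l = sumz ν + d then (if interQ κ l then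
        phiHL t l κ * y (Fin.last k) ^ (sumz l - sumz κ) * HLQ t k ν κ (fun i => y i.castSucc)
      else 0) * Pn t n l x else 0 := by
      intro κ _
      rw [← Finset.mul_sum]
      by_cases h0 : HLQ t k ν κ (fun i => y i.castSucc) = 0
      · simp [h0]
      have hs := HLQ_supp _ _ _ _ _ hν h0
      by_cases h2 : interQ κ l
      · have hle := interQ_sumz h2
        rw [antidiag_sum d (sumz ν) (sumz κ) (sumz l) (Finset.sum_le_sum fun i _ => hs.2 i) hle]
        simp only [h2, if_true]
        split_ifs with h3
        · have : y (Fin.last k) ^ (sumz l - sumz κ) = y (Fin.last k) ^ (sumz l - sumz κ).toNat := by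
            rw [← zpow_natCast, Int.toNat_of_nonneg (by omega)]
          rw [this]; ring
        · ring
      · simp [h2]
    rw [Finset.sum_congr rfl fin]
    split_ifs with h
    · rw [Finset.sum_mul]
    · simp

open PowerSeries in
lemma resc_factor {K : Type} [Field K] (t x y : K) :
    rescale y ((1 - C (t * x) * X) * mk (fun d => x ^ d)) = (1 - C (t * (x * y)) * X) * mk (fun d => (x * y) ^ d) := by
  rw [map_mul]
  congr 1
  · rw [map_sub, map_one, map_mul, rescale_X]
    have : rescale y (C (t * x)) = C (t * x) := by
      ext d; rw [coeff_rescale, coeff_C]; split_ifs with h <;> simp [h]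
    rw [this, ← mul_assoc, ← map_mul, mul_assoc]
  · ext d; rw [coeff_rescale, coeff_mk, coeff_mk, mul_pow, mul_comm]

open PowerSeries in
lemma pair_factor {K : Type} [Field K] (t a : K) :
    ((1 - C (-t * a) * X) * mk (fun d => a ^ d)) * ((1 - C (-t * -a) * X) * mk (fun d => (-a) ^ d)) =
    expand 2 two_ne_zero ((1 - C (t ^ 2 * a ^ 2) * X) * mk (fun d => (a ^ 2) ^ d)) := by
  have h1 := geom_inv a
  have h2 := geom_inv (-a)
  have h3 := congrArg (expand 2 two_ne_zero) (geom_inv (a ^ 2))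
  rw [map_mul, map_sub, map_mul, expand_C, expand_X, map_one] at h3
  have he : expand 2 two_ne_zero ((1 - C (t ^ 2 * a ^ 2) * X) * mk (fun d => (a ^ 2) ^ d)) =
      (1 - C (t ^ 2 * a ^ 2) * X ^ 2) * expand 2 two_ne_zero (mk (fun d => (a ^ 2) ^ d)) := by
    rw [map_mul, map_sub, map_mul, expand_C, expand_X, map_one]
  rw [he]
  clear he
  set E := expand 2 two_ne_zero (mk (fun d => (a ^ 2) ^ d)) with hE
  set A := mk (fun d => a ^ d) with hA
  set B := mk (fun d => (-a) ^ d) with hB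
  simp only [map_mul, map_neg, map_pow] at *
  have key : A * B = E := by
    linear_combination (-(A * B)) * h3 + E * ((1 - -C a * X) * B) * h1 + E * h2
  linear_combination (1 - C t ^ 2 * C a ^ 2 * X ^ 2) * key

lemma prod_pairs {R : Type} [CommRing R] (m : ℕ) (f : ℕ → R) :
    ∏ i ∈ Finset.range (2 * m), f i = ∏ j ∈ Finset.range m, (f (2 * j) * f (2 * j + 1)) := by
  induction m with
  | zero => simp
  | succ m ih => 
    rw [Finset.prod_range_succ, ← ih, show 2 * (m + 1) = 2 * m + 1 + 1 by ring, Finset.prod_range_succ,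
      Finset.prod_range_succ]; ring

open PowerSeries in
lemma pair_gser {K : Type} [Field K] (t : K) {n : ℕ} (x : Fin n → K) (y : K) :
    rescale y (gser (-t) x) * rescale (-y) (gser (-t) x) =
      expand 2 two_ne_zero (rescale (y ^ 2) (gser (t ^ 2) (fun i => x i ^ 2))) := by
  unfold gser
  simp only [map_prod]
  rw [← Finset.prod_mul_distrib]
  refine Finset.prod_congr rfl fun i _ => ?_
  rw [resc_factor, resc_factor, resc_factor, ← mul_pow, mul_neg, pair_factor]

open PowerSeries in
lemma sign_gser {K : Type} [Field K] (t : K) {n m : ℕ} (x : Fin n → K) (y : Fin m → K) :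
    ∏ j, rescale (signList y j) (gser (-t) x) =
      expand 2 two_ne_zero (∏ j, rescale (y j ^ 2) (gser (t ^ 2) (fun i => x i ^ 2))) := by
  rw [map_prod]
  set z : ℕ → K := fun i => if h : i < m then y ⟨i, h⟩ else 0 with hz
  have h1 : ∏ j, rescale (signList y j) (gser (-t) x) =
      ∏ i ∈ Finset.range (2 * m), rescale ((-1 : K) ^ (i % 2) * z (i / 2)) (gser (-t) x) := by
    rw [Finset.prod_range]
    refine Finset.prod_congr rfl fun i _ => ?_
    rw [signList]
    have : (i : ℕ) / 2 < m := by have := i.2; omega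
    simp only [hz, this, dite_true]
  rw [h1, prod_pairs, Finset.prod_range]
  refine Finset.prod_congr rfl fun j _ => ?_
  rw [← pair_gser]
  have e1 : (2 * (j : ℕ)) % 2 = 0 := by omega
  have e2 : (2 * (j : ℕ)) / 2 = j := by omega
  have e3 : (2 * (j : ℕ) + 1) % 2 = 1 := by omega
  have e4 : (2 * (j : ℕ) + 1) / 2 = j := by omega
  rw [e1, e2, e3, e4]
  simp [hz]

lemma Pn_hom {K : Type} [Field K] (t : K) (s : K) (hs : s ≠ 0) (n : ℕ) : ∀ (l : Fin n → ℤ) (x : Fin n → K),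
    Pn t n l (fun i => s * x i) = s ^ sumz l * Pn t n l x := by
  induction n with
  | zero => intro l x; simp [Pn, sumz]
  | succ n ih =>
    intro l x
    rw [Pn, Pn, Finset.mul_sum]
    refine Finset.sum_congr rfl fun ν _ => ?_
    rw [ih, mul_zpow, show s ^ sumz l = s ^ (sumz l - sumz ν) * s ^ sumz ν by rw [← zpow_add₀ hs]; congr 1; ring]
    ring

lemma low_coeff {K : Type} [Field K] [Infinite K] {ι : Type} (S : Finset ι) (b : ι → K) (e : ι → ℤ) (c : ℤ)
    (he : ∀ i ∈ S, c ≤ e i) (h : ∀ y : K, y ≠ 0 → ∑ i ∈ S, b i * y ^ e i = 0) :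
    ∑ i ∈ S.filter (fun i => e i = c), b i = 0 := by
  set p : Polynomial K := ∑ i ∈ S, Polynomial.C (b i) * Polynomial.X ^ (e i - c).toNat with hp
  have hev : ∀ y : K, y ≠ 0 → p.eval y = 0 := by
    intro y hy
    rw [hp, Polynomial.eval_finset_sum]
    have := h y hy
    have h2 : ∑ i ∈ S, Polynomial.eval y (Polynomial.C (b i) * Polynomial.X ^ (e i - c).toNat) =
        y ^ (-c) * ∑ i ∈ S, b i * y ^ e i := by
      rw [Finset.mul_sum]
      refine Finset.sum_congr rfl fun i hi => ?_
      have hh := he i hi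
      simp only [Polynomial.eval_mul, Polynomial.eval_C, Polynomial.eval_pow, Polynomial.eval_X]
      rw [← zpow_natCast, Int.toNat_of_nonneg (by omega), zpow_sub₀ hy, zpow_neg]
      field_simp
    rw [h2, this, mul_zero]
  have hp0 : Polynomial.X * p = 0 := by
    apply Polynomial.funext
    intro y
    by_cases hy : y = 0
    · simp [hy]
    · simp [hev y hy]
  have hp1 : p = 0 := by simpa using hp0
  have hc := congrArg (fun q => Polynomial.coeff q 0) hp1
  simp only [hp, Polynomial.finset_sum_coeff, Polynomial.coeff_C_mul_X_pow, Polynomial.coeff_zero] at hc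
  rw [Finset.sum_filter]
  refine Eq.trans ?_ hc
  refine Finset.sum_congr rfl fun i hi => ?_
  have hh := he i hi
  apply if_congr _ rfl rfl
  omega

lemma mcount_init {n : ℕ} (l : Fin (n + 1) → ℤ) (c : ℤ) : mcount (fun i : Fin n => l i.castSucc) c ≤ mcount l c := by
  unfold mcount
  apply Finset.card_le_card_of_injOn Fin.castSucc
  · intro i; simp
  · intro i _ j _ h; simpa using h

lemma psi_init {K : Type} [Field K] (t : K) {n : ℕ} (l : Fin (n + 1) → ℤ) :
    psiHL t l (fun i : Fin n => l i.castSucc) = 1 := by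
  unfold psiHL
  refine Eq.trans (finprod_congr (g := fun _ : ℤ => (1 : K)) ?_) finprod_one
  intro c
  have := mcount_init l c
  rw [if_neg (by omega)]

lemma init_mem {n : ℕ} {l : Fin (n + 1) → ℤ} (hl : IsSig l) : (fun i : Fin n => l i.castSucc) ∈ Dn l := by
  rw [mem_Dn]
  intro i
  exact ⟨le_rfl, hl _ _ (by simp [Fin.le_def])⟩

lemma exp_ge {n : ℕ} {l : Fin (n + 1) → ℤ} {ν : Fin n → ℤ} (h : ν ∈ Dn l) : l (Fin.last n) ≤ sumz l - sumz ν := by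
  rw [mem_Dn] at h
  unfold sumz
  rw [Fin.sum_univ_castSucc]
  have := Finset.sum_le_sum (s := Finset.univ) fun i _ => (h i).1
  linarith

lemma exp_eq {n : ℕ} {l : Fin (n + 1) → ℤ} {ν : Fin n → ℤ} (h : ν ∈ Dn l)
    (he : sumz l - sumz ν = l (Fin.last n)) : ν = fun i : Fin n => l i.castSucc := by
  rw [mem_Dn] at h
  unfold sumz at he
  rw [Fin.sum_univ_castSucc] at he
  have h2 := (Finset.sum_eq_sum_iff_of_le (s := Finset.univ) fun i _ => (h i).1).1 (by linarith)
  ext i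
  exact h2 i (Finset.mem_univ i)

lemma lin_indep {K : Type} [Field K] [Infinite K] (t : K) (n : ℕ) : ∀ (S : Finset (Fin n → ℤ)) (_ : ∀ κ ∈ S, IsSig κ)
    (a : (Fin n → ℤ) → K) (_ : ∀ x : Fin n → K, (∀ i, x i ≠ 0) → ∑ κ ∈ S, a κ * Pn t n κ x = 0),
    ∀ κ ∈ S, a κ = 0 := by
  induction n with
  | zero =>
    intro S _ a h κ hκ
    have := h (fun _ => 1) (by simp)
    have hS : S = {κ} := by
      ext l; simp; constructor
      · intro _; exact Subsingleton.elim _ _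
      · rintro rfl; exact hκ
    simpa [hS, Pn] using this
  | succ n ih =>
    intro S hS a h
    by_contra hcon
    push Not at hcon
    obtain ⟨κ0, hκ0, ha0⟩ := hcon
    set S' := S.filter (fun κ => a κ ≠ 0) with hS'
    obtain ⟨κ1, hκ1, hmin⟩ := Finset.exists_min_image S' (fun κ => κ (Fin.last n)) ⟨κ0, by simp [hS', hκ0, ha0]⟩
    set c := κ1 (Fin.last n) with hc
    set T := S'.filter (fun κ => κ (Fin.last n) = c) with hT
    have hsig : ∀ κ ∈ S', IsSig κ := fun κ hκ => hS κ (Finset.mem_filter.1 hκ).1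
    have key : ∀ x : Fin n → K, (∀ i, x i ≠ 0) → ∑ κ ∈ T, a κ * Pn t n (fun i => κ i.castSucc) x = 0 := by
      intro x hx
      have hl := low_coeff (S'.sigma fun κ => Dn κ) (fun p => a p.1 * (psiHL t p.1 p.2 * Pn t n p.2 x))
        (fun p => sumz p.1 - sumz p.2) c ?_ ?_
      · rw [← hl]
        apply Finset.sum_of_injOn (fun κ => (⟨κ, fun i => κ i.castSucc⟩ : Σ _ : Fin (n + 1) → ℤ, Fin n → ℤ))
        · intro κ _ κ' _ hE
          simp only [Sigma.mk.injEq] at hE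
          exact hE.1
        · intro κ hκ
          have hκ := Finset.mem_filter.1 hκ
          simp only [Finset.coe_filter, Finset.mem_sigma, Set.mem_ofPred_eq]
          refine ⟨⟨hκ.1, init_mem (hsig κ hκ.1)⟩, ?_⟩
          unfold sumz
          rw [Fin.sum_univ_castSucc]
          have := hκ.2
          linarith
        · rintro ⟨κ, ν⟩ hp hn
          exfalso
          apply hn
          rw [Finset.mem_filter, Finset.mem_sigma] at hp
          simp only at hp
          have h1 := exp_ge hp.1.2
          have h2 := hmin κ hp.1.1
          have h3 : κ (Fin.last n) = c := by omega
          have h4 := exp_eq hp.1.2 (by omega)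
          exact ⟨κ, by simp [hT, hp.1.1, h3], by simp [h4]⟩
        · intro κ _
          simp only [psi_init, one_mul]
      · rintro ⟨κ, ν⟩ hp
        rw [Finset.mem_sigma] at hp
        have h1 := exp_ge hp.2
        have h2 := hmin κ hp.1
        simp only at *
        omega
      · intro y hy
        have hh := h (Fin.snoc x y) (by
          intro i
          refine Fin.lastCases ?_ (fun j => ?_) i
          · simpa using hy
          · simpa using hx j)
        rw [Finset.sum_sigma]
        rw [← hh, ← Finset.sum_filter_ne_zero S]
        have hsub : S.filter (fun κ => a κ * Pn t (n + 1) κ (Fin.snoc x y) ≠ 0) ⊆ S' := by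
          intro κ hκ
          rw [Finset.mem_filter] at hκ
          rw [hS', Finset.mem_filter]
          exact ⟨hκ.1, left_ne_zero_of_mul hκ.2⟩
        rw [Finset.sum_subset hsub]
        · refine Finset.sum_congr rfl fun κ _ => ?_
          rw [Pn, Finset.mul_sum]
          refine Finset.sum_congr rfl fun ν _ => ?_
          simp only [Fin.snoc_last, Fin.snoc_castSucc]
          ring
        · intro κ hκ hn
          by_contra hne
          exact hn (by rw [Finset.mem_filter]; exact ⟨(Finset.mem_filter.1 hκ).1, hne⟩)
    have inj : Set.InjOn (fun (κ : Fin (n + 1) → ℤ) (i : Fin n) => κ i.castSucc) (T : Set (Fin (n + 1) → ℤ)) := by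
      intro κ hκ κ' hκ' hE
      have e1 := (Finset.mem_filter.1 hκ).2
      have e2 := (Finset.mem_filter.1 hκ').2
      ext i
      refine Fin.lastCases ?_ (fun j => ?_) i
      · rw [e1, e2]
      · exact congrFun hE j
    have fin := ih (T.image (fun (κ : Fin (n + 1) → ℤ) (i : Fin n) => κ i.castSucc)) ?_
      (fun ν => a (Fin.snoc (α := fun _ => ℤ) ν c)) ?_ (fun i => κ1 i.castSucc) ?_
    · have e : (Fin.snoc (α := fun _ => ℤ) (fun i : Fin n => κ1 i.castSucc) c) = κ1 := by
        ext i
        refine Fin.lastCases ?_ (fun j => ?_) i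
        · simp [hc]
        · simp
      rw [e] at fin
      exact (Finset.mem_filter.1 hκ1).2 fin
    · intro ν hν
      obtain ⟨κ, hκ, rfl⟩ := Finset.mem_image.1 hν
      have := hsig κ (Finset.mem_filter.1 hκ).1
      intro i j hij
      exact this _ _ (by simpa using hij)
    · intro x hx
      rw [Finset.sum_image inj, ← key x hx]
      refine Finset.sum_congr rfl fun κ hκ => ?_
      congr 2
      have e2 := (Finset.mem_filter.1 hκ).2
      ext i
      refine Fin.lastCases ?_ (fun j => ?_) i
      · simp [e2]
      · simp
    · exact Finset.mem_image.2 ⟨κ1, by simp [hT, hκ1, hc], rfl⟩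

lemma Pn_zero {K : Type} [Field K] (t : K) (n : ℕ) : ∀ x : Fin n → K, Pn t n (fun _ => 0) x = 1 := by
  induction n with
  | zero => intro x; rw [Pn]
  | succ n ih =>
    intro x
    have : Dn (fun _ : Fin (n + 1) => (0 : ℤ)) = {fun _ => 0} := by
      ext l; simp [Dn, funext_iff]
    rw [Pn, this, Finset.sum_singleton, ih]
    have h := psi_init t (fun _ : Fin (n + 1) => (0 : ℤ))
    rw [h]; simp [sumz]

lemma phi_map {K L : Type} [Field K] [Field L] (f : K →+* L) {n : ℕ} (t : K) (l κ : Fin n → ℤ) :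
    f (phiHL t l κ) = phiHL (f t) l κ := by
  unfold phiHL
  refine (MonoidHom.map_finprod_of_injective f.toMonoidHom f.injective _).trans ?_
  apply finprod_congr
  intro c
  split_ifs <;> simp

lemma HLQ_map {K L : Type} [Field K] [Field L] (f : K →+* L) {n : ℕ} (t : K) (k : ℕ) :
    ∀ (ν l : Fin n → ℤ) (y : Fin k → K), f (HLQ t k ν l y) = HLQ (f t) k ν l (fun i => f (y i)) := by
  induction k with
  | zero => intro ν l y; rw [HLQ, HLQ]; split_ifs <;> simp
  | succ k ih =>
    intro ν l y
    rw [HLQ, HLQ]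
    refine (AddMonoidHom.map_finsum_of_injective f.toAddMonoidHom f.injective _).trans ?_
    apply finsum_congr
    intro κ
    split_ifs with h
    · rw [← ih, ← phi_map, ← map_zpow₀, ← map_mul, ← map_mul]; rfl
    · simp

lemma her_deg {K : Type} [Field K] [Infinite K] (n : ℕ) (μ ν : Fin n → ℤ) (c : (Fin n → ℤ) → Polynomial ℤ)
    (hc : herExpand n μ ν c) (t : K) (l : Fin n → ℤ) (hne : Polynomial.aeval t (c l) ≠ 0) :
    sumz l = sumz ν + 2 * sumz μ := by
  obtain ⟨h1, h2, h3⟩ := hc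
  by_contra hs
  apply hne
  have hsum : ∀ x : Fin n → K, (∀ i, x i ≠ 0) → Pn (t ^ 2) n μ (fun i => x i ^ 2) * Pn (-t) n ν x =
      ∑ κ ∈ h1.toFinset, Polynomial.aeval t (c κ) * Pn (-t) n κ x := by
    intro x hx
    have := h3 K t x hx
    simp only [HLPfull_eq] at this
    rw [this]
    apply finsum_eq_sum_of_support_subset
    intro κ hκ
    simp only [Set.Finite.coe_toFinset]
    intro h0
    apply hκ
    simp only
    rw [h0]; simp
  have hcl : c l ≠ 0 := by intro h; apply hne; rw [h]; simp
  have hall : ∀ s : K, s ≠ 0 → Polynomial.aeval t (c l) * s ^ sumz l - 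
      Polynomial.aeval t (c l) * s ^ (sumz ν + 2 * sumz μ) = 0 := by
    intro s hs0
    have := lin_indep (-t) n h1.toFinset (fun κ hκ => h2 κ (by simpa using hκ))
      (fun κ => Polynomial.aeval t (c κ) * s ^ sumz κ - Polynomial.aeval t (c κ) * s ^ (sumz ν + 2 * sumz μ)) ?_ l
      (by simpa using hcl)
    · exact this
    · intro x hx
      have e1 := hsum x hx
      have e2 := hsum (fun i => s * x i) (fun i => mul_ne_zero hs0 (hx i))
      simp only [mul_pow] at e2
      rw [Pn_hom _ (s ^ 2) (pow_ne_zero 2 hs0) n μ (fun i => x i ^ 2), Pn_hom _ s hs0] at e2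
      simp only [Pn_hom _ s hs0] at e2
      simp only [sub_mul]
      rw [Finset.sum_sub_distrib, sub_eq_zero]
      have e3 : ∑ κ ∈ h1.toFinset, Polynomial.aeval t (c κ) * s ^ (sumz ν + 2 * sumz μ) * Pn (-t) n κ x =
        s ^ (sumz ν + 2 * sumz μ) * ∑ κ ∈ h1.toFinset, Polynomial.aeval t (c κ) * Pn (-t) n κ x := by
        rw [Finset.mul_sum]
        exact Finset.sum_congr rfl fun κ _ => by ring
      rw [e3, ← e1]
      simp only [mul_assoc]
      rw [← e2, zpow_add₀ hs0, zpow_mul]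
      simp only [zpow_ofNat]
      ring
  rcases lt_or_gt_of_ne hs with h | h
  · have := low_coeff (K := K) (Finset.univ : Finset Bool)
      (fun b => if b then Polynomial.aeval t (c l) else - Polynomial.aeval t (c l))
      (fun b => if b then sumz l else sumz ν + 2 * sumz μ) (sumz l) (by simp; omega)
      (fun y hy => by have := hall y hy; simp; linear_combination this)
    have hne' : ¬ (sumz ν + 2 * sumz μ = sumz l) := by omega
    simpa [Finset.sum_filter, hne'] using this
  · have := low_coeff (K := K) (Finset.univ : Finset Bool)
      (fun b => if b then Polynomial.aeval t (c l) else - Polynomial.aeval t (c l))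
      (fun b => if b then sumz l else sumz ν + 2 * sumz μ) (sumz ν + 2 * sumz μ) (by simp; omega)
      (fun y hy => by have := hall y hy; simp; linear_combination this)
    have hne' : ¬ (sumz l = sumz ν + 2 * sumz μ) := by omega
    simpa [Finset.sum_filter, hne'] using this

lemma exists_win {n : ℕ} (l ν : Fin n → ℤ) (d : ℕ) : ∃ lo hi : ℤ, InW ν lo (hi - d) ∧ InW l lo hi := by
  refine ⟨-(∑ i, (|l i| + |ν i|)), (∑ i, (|l i| + |ν i|)) + d + 1, ?_, ?_⟩ <;> intro i
  all_goals
    have := Finset.single_le_sum (f := fun i => |l i| + |ν i|) (s := Finset.univ)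
      (fun j _ => by positivity) (Finset.mem_univ i)
    have a1 := abs_le.1 (le_refl |l i|)
    have a2 := abs_le.1 (le_refl |ν i|)
    have a3 := abs_nonneg (l i)
    have a4 := abs_nonneg (ν i)
    constructor <;> omega

lemma main_inf (n m : ℕ) 
    (l ν : Fin n → ℤ) (hl : IsSig l) (hν : IsSig ν)
    (c : (Fin n → ℤ) → (Fin n → ℤ) → Polynomial ℤ)
    (hc : ∀ μ : Fin n → ℤ, IsSig μ → (∀ i, 0 ≤ μ i) → herExpand n μ ν (c μ))
    (K : Type) [Field K] [Infinite K] (t : K) (x : Fin m → K) :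
    (∑ᶠ μ : Fin n → ℤ,
        if IsSig μ ∧ ∀ i, 0 ≤ μ i then
          Polynomial.aeval t (c μ l) * HLQ (t ^ 2) m (fun _ => 0) μ (fun i => x i ^ 2)
        else 0)
      = HLQ (-t) (2 * m) ν l (signList x) := by
  by_cases hd : ∃ d : ℕ, sumz l = sumz ν + d
  swap
  · rw [finsum_eq_zero_of_forall_eq_zero]
    · by_contra h
      have := HLQ_supp _ _ _ _ _ hν (Ne.symm h)
      have h2 : sumz ν ≤ sumz l := Finset.sum_le_sum fun i _ => this.2 i
      exact hd ⟨(sumz l - sumz ν).toNat, by omega⟩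
    · intro μ
      split_ifs with h
      · by_contra h0
        have h1 := her_deg n μ ν (c μ) (hc μ h.1 h.2) t l (left_ne_zero_of_mul h0)
        have h2 : 0 ≤ sumz μ := Finset.sum_nonneg fun i _ => h.2 i
        exact hd ⟨(2 * sumz μ).toNat, by omega⟩
      · rfl
  obtain ⟨d, hd⟩ := hd
  obtain ⟨lo, hi, wν, wl⟩ := exists_win l ν d
  have cau := fun (z : Fin n → K) (hz : ∀ i, z i ≠ 0) => cauchy (-t) n ν hν z hz lo hi (2 * m) (signList x) d wν
  simp only [sign_gser] at cau
  rcases Nat.even_or_odd' d with ⟨e, he | he⟩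
  swap
  · rw [finsum_eq_zero_of_forall_eq_zero]
    · have := lin_indep (-t) n (SigW n lo hi) (fun κ hκ => (mem_SigW.1 hκ).2)
        (fun κ => if sumz κ = sumz ν + d then HLQ (-t) (2 * m) ν κ (signList x) else 0) ?_ l (mem_SigW.2 ⟨wl, hl⟩)
      · simp only [hd, if_true] at this
        exact this.symm
      · intro z hz
        have := cau z hz
        rw [PowerSeries.coeff_expand_of_not_dvd _ _ _ (by omega), mul_zero] at this
        refine Eq.trans ?_ this
        exact Finset.sum_congr rfl fun κ _ => by split_ifs <;> simp
    · intro μ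
      split_ifs with h
      · by_contra h0
        have h1 := her_deg n μ ν (c μ) (hc μ h.1 h.2) t l (left_ne_zero_of_mul h0)
        omega
      · rfl
  have cau0 := fun (z : Fin n → K) (hz : ∀ i, z i ≠ 0) => cauchy (t ^ 2) n (fun _ => 0) (fun _ _ _ => le_rfl)
    (fun i => z i ^ 2) (fun i => pow_ne_zero 2 (hz i)) 0 (e + 1) m (fun i => x i ^ 2) e (by intro i; simp)
  simp only [Pn_zero, one_mul] at cau0
  have hs0 : sumz (fun _ : Fin n => (0 : ℤ)) = 0 := by simp [sumz]
  simp only [hs0, zero_add] at cau0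
  have hμ : ∀ μ ∈ SigW n 0 ((e : ℤ) + 1), IsSig μ ∧ ∀ i, 0 ≤ μ i := fun μ h =>
    ⟨(mem_SigW.1 h).2, fun i => ((mem_SigW.1 h).1 i).1⟩
  -- the left side as a finite sum
  have lhs : (∑ᶠ μ : Fin n → ℤ, if IsSig μ ∧ ∀ i, 0 ≤ μ i then
          Polynomial.aeval t (c μ l) * HLQ (t ^ 2) m (fun _ => 0) μ (fun i => x i ^ 2) else 0) =
      ∑ μ ∈ SigW n 0 ((e : ℤ) + 1), if sumz μ = e then
        HLQ (t ^ 2) m (fun _ => 0) μ (fun i => x i ^ 2) * Polynomial.aeval t (c μ l) else 0 := by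
    have deg : ∀ μ : Fin n → ℤ, (IsSig μ ∧ ∀ i, 0 ≤ μ i) → Polynomial.aeval t (c μ l) ≠ 0 → sumz μ = e := by
      intro μ h h0
      have h1 := her_deg n μ ν (c μ) (hc μ h.1 h.2) t l h0
      omega
    rw [finsum_eq_sum_of_support_subset (s := SigW n 0 ((e : ℤ) + 1))]
    · refine Finset.sum_congr rfl fun μ hm => ?_
      rw [if_pos (hμ μ hm)]
      by_cases h0 : Polynomial.aeval t (c μ l) = 0
      · simp [h0]
      · rw [if_pos (deg μ (hμ μ hm) h0), mul_comm]
    · intro μ hm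
      rw [Function.mem_support] at hm
      split_ifs at hm with h
      · have h1 := deg μ h (left_ne_zero_of_mul hm)
        rw [Finset.mem_coe, mem_SigW]
        refine ⟨fun i => ⟨h.2 i, ?_⟩, h.1⟩
        have := sum_bd (ν := fun _ => 0) h.2 e (by rw [hs0, h1, zero_add]) i
        omega
      · simp at hm
  rw [lhs]
  -- finite set containing everything
  have hfin : ∃ S : Finset (Fin n → ℤ), (∀ κ ∈ S, IsSig κ) ∧ SigW n lo hi ⊆ S ∧
      ∀ μ ∈ SigW n 0 ((e : ℤ) + 1), ∀ κ, c μ κ ≠ 0 → κ ∈ S := by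
    refine ⟨SigW n lo hi ∪ (SigW n 0 ((e : ℤ) + 1)).attach.biUnion (fun μ =>
      (hc μ.1 (hμ μ.1 μ.2).1 (hμ μ.1 μ.2).2).1.toFinset), ?_, Finset.subset_union_left, ?_⟩
    · intro κ hκ
      rw [Finset.mem_union, Finset.mem_biUnion] at hκ
      rcases hκ with hκ | ⟨μ, -, hκ⟩
      · exact (mem_SigW.1 hκ).2
      · exact (hc μ.1 (hμ μ.1 μ.2).1 (hμ μ.1 μ.2).2).2.1 κ (by simpa using hκ)
    · intro μ hm κ hκ
      rw [Finset.mem_union, Finset.mem_biUnion]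
      right
      exact ⟨⟨μ, hm⟩, Finset.mem_attach _ _, by simpa using hκ⟩
  obtain ⟨S, S1, S2, S3⟩ := hfin
  have hS := lin_indep (-t) n S S1 (fun κ => (∑ μ ∈ SigW n 0 ((e : ℤ) + 1), if sumz μ = e then
        HLQ (t ^ 2) m (fun _ => 0) μ (fun i => x i ^ 2) * Polynomial.aeval t (c μ κ) else 0) -
      (if κ ∈ SigW n lo hi then (if sumz κ = sumz ν + d then HLQ (-t) (2 * m) ν κ (signList x) else 0) else 0))
      ?_ l (S2 (mem_SigW.2 ⟨wl, hl⟩))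
  · simp only [hd, if_true] at hS
    rw [if_pos (mem_SigW.2 ⟨wl, hl⟩)] at hS
    exact sub_eq_zero.1 hS
  · intro z hz
    simp only [sub_mul]
    rw [Finset.sum_sub_distrib, sub_eq_zero]
    have r : ∑ κ ∈ S, (if κ ∈ SigW n lo hi then
        (if sumz κ = sumz ν + d then HLQ (-t) (2 * m) ν κ (signList x) else 0) else 0) * Pn (-t) n κ z =
        ∑ κ ∈ SigW n lo hi, if sumz κ = sumz ν + d then HLQ (-t) (2 * m) ν κ (signList x) * Pn (-t) n κ z else 0 := by
      rw [← Finset.sum_subset S2]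
      · refine Finset.sum_congr rfl fun κ hκ => ?_
        rw [if_pos hκ]; split_ifs <;> simp
      · intro κ _ hn
        rw [if_neg hn, zero_mul]
    rw [r, cau z hz, he, PowerSeries.coeff_expand_mul, ← cau0 z hz, Finset.mul_sum]
    simp only [Finset.sum_mul]
    rw [Finset.sum_comm]
    refine Finset.sum_congr rfl fun μ hm => ?_
    split_ifs with h1
    · have h3 := (hc μ (hμ μ hm).1 (hμ μ hm).2).2.2 K t z hz
      simp only [HLPfull_eq] at h3
      rw [finsum_eq_sum_of_support_subset (s := S)] at h3
      · rw [mul_left_comm, mul_comm (Pn (-t) n ν z), h3, Finset.mul_sum]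
        exact Finset.sum_congr rfl fun κ _ => by ring
      · intro κ hκ
        apply S3 μ hm
        intro h0
        apply hκ
        simp only
        rw [h0]; simp
    · simp

lemma aeval_fieldHom {F G : Type} [Field F] [Field G] (f : F →+* G) (t : F) (p : Polynomial ℤ) :
    Polynomial.aeval (f t) p = f (Polynomial.aeval t p) := by
  rw [Polynomial.aeval_def, Polynomial.aeval_def, Polynomial.hom_eval₂]
  congr 1
  exact RingHom.ext_int _ _

/-- for the Hermitian Littlewood–Richardson coefficients `c_{μ,ν}^{her,κ}(t)`,
`∑_{μ ∈ Sig_n⁺} c_{μ,ν}^{her,λ}(t) Q_{μ/0[n]}(x₁²,…,x_m²;t²)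
  = Q_{λ/ν}(x₁, −x₁, …, x_m, −x_m; −t)`
as Laurent polynomials in `x₁,…,x_m` with coefficients in `ℤ[t]`. -/
theorem stmt17 (n m : ℕ) (hn : 1 ≤ n) (hm : 1 ≤ m)
    (l ν : Fin n → ℤ) (hl : IsSig l) (hν : IsSig ν)
    (c : (Fin n → ℤ) → (Fin n → ℤ) → Polynomial ℤ)
    (hc : ∀ μ : Fin n → ℤ, IsSig μ → (∀ i, 0 ≤ μ i) → herExpand n μ ν (c μ))
    (K : Type) [Field K] (t : K) (x : Fin m → K) (hx : ∀ i, x i ≠ 0) :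
    (∑ᶠ μ : Fin n → ℤ,
        if IsSig μ ∧ ∀ i, 0 ≤ μ i then
          Polynomial.aeval t (c μ l) * HLQ (t ^ 2) m (fun _ => 0) μ (fun i => x i ^ 2)
        else 0)
      = HLQ (-t) (2 * m) ν l (signList x) := by
  haveI : Infinite (AlgebraicClosure K) := IsAlgClosed.instInfinite
  set f : K →+* AlgebraicClosure K := algebraMap K (AlgebraicClosure K) with hf
  have h := main_inf n m l ν hl hν c hc (AlgebraicClosure K) (f t) (fun i => f (x i))
  apply f.injective
  rw [HLQ_map]
  have e1 : (fun i => f (signList x i)) = signList (fun i => f (x i)) := by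
    ext i; simp [signList]
  rw [e1, map_neg, ← h]
  refine (AddMonoidHom.map_finsum_of_injective f.toAddMonoidHom f.injective _).trans ?_
  apply finsum_congr
  intro μ
  split_ifs with h1
  · have e2 := HLQ_map f (t ^ 2) m (fun _ => 0) μ (fun i => x i ^ 2)
    simp only [map_pow] at e2
    rw [← e2]
    have e3 := aeval_fieldHom f t (c μ l)
    rw [e3, ← map_mul]; rfl
  · simp

end
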